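/- arXiv:1303.2952 — 2 statements merged into one kernel-verified Lean document; each statement's English description precedes it below -/
import Mathlib

section
/- There exist constants α > 0 and c > 0 and an infinite sequence of finite connected simple graphs G₁, G₂, … with |V(G_i)| strictly increasing, such that every G_i has maximum degree at most 4 and edge expansion at least α, and each G_i contains a vertex w_i for which the number of unordered pairs {u,v} of distinct vertices of G_i such that every shortest path in G_i between u and v passes through w_i is at least c·|V(G_i)|². In particular, there is a family of constant-degree expanders whose maximum vertex congestion under geodesic routing is Θ(n²). -/
open SimpleGraph

namespace ExpCong

section Fourier
variable {M : ℕ} [NeZero M]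

noncomputable def ft (f : ZMod M × ZMod M → ℂ) (z : ZMod M × ZMod M) : ℂ :=
  ∑ w, f w * ZMod.stdAddChar (z.1 * w.1 + z.2 * w.2)

lemma sum_char (b : ZMod M × ZMod M) :
    ∑ z : ZMod M × ZMod M, (ZMod.stdAddChar (z.1 * b.1 + z.2 * b.2) : ℂ)
      = if b = 0 then (M : ℂ) ^ 2 else 0 := by
  have h1 : ∀ z : ZMod M × ZMod M, (ZMod.stdAddChar (z.1 * b.1 + z.2 * b.2) : ℂ)
      = ZMod.stdAddChar (z.1 * b.1) * ZMod.stdAddChar (z.2 * b.2) := fun z =>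
    AddChar.map_add_eq_mul _ _ _
  simp_rw [h1]
  rw [Fintype.sum_prod_type]
  simp_rw [← Finset.mul_sum, ← Finset.sum_mul]
  rw [AddChar.sum_mulShift _ (ZMod.isPrimitive_stdAddChar M),
    AddChar.sum_mulShift _ (ZMod.isPrimitive_stdAddChar M)]
  rcases b with ⟨b1, b2⟩
  by_cases h1 : b1 = 0 <;> by_cases h2 : b2 = 0 <;> simp [h1, h2, ZMod.card, sq]

lemma conj_char (a : ZMod M) : (starRingEnd ℂ) (ZMod.stdAddChar a) = ZMod.stdAddChar (-a) := by
  rw [AddChar.map_neg_eq_conj]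

lemma plancherel (f : ZMod M × ZMod M → ℂ) :
    ∑ z, ‖ft f z‖ ^ 2 = (M : ℝ) ^ 2 * ∑ w, ‖f w‖ ^ 2 := by
  have key : ∑ z, ft f z * (starRingEnd ℂ) (ft f z) = (M : ℂ) ^ 2 * ∑ w, f w * (starRingEnd ℂ) (f w) := by
    have h1 : ∀ z, ft f z * (starRingEnd ℂ) (ft f z) = ∑ w, ∑ w', f w * (starRingEnd ℂ) (f w') *
        ZMod.stdAddChar (z.1 * (w - w').1 + z.2 * (w - w').2) := by
      intro z
      unfold ft
      rw [map_sum, Finset.sum_mul_sum]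
      refine Finset.sum_congr rfl fun w _ => Finset.sum_congr rfl fun w' _ => ?_
      rw [map_mul, conj_char]
      have : z.1 * (w - w').1 + z.2 * (w - w').2
        = (z.1 * w.1 + z.2 * w.2) + (-(z.1 * w'.1 + z.2 * w'.2)) := by
        simp only [Prod.fst_sub, Prod.snd_sub]; ring
      rw [this, AddChar.map_add_eq_mul _ (z.1 * w.1 + z.2 * w.2)]; ring
    simp_rw [h1]
    rw [Finset.sum_comm]
    rw [Finset.mul_sum]
    refine Finset.sum_congr rfl fun w _ => ?_
    rw [Finset.sum_comm]
    simp_rw [← Finset.mul_sum, sum_char, sub_eq_zero]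
    simp
    ring
  have h2 : ∀ c : ℂ, c * (starRingEnd ℂ) c = ((‖c‖ ^ 2 : ℝ) : ℂ) := by
    intro c; rw [Complex.mul_conj']; push_cast; rfl
  simp_rw [h2] at key
  exact_mod_cast key

lemma ft_sub (f g : ZMod M × ZMod M → ℂ) (z) : ft (fun w => f w - g w) z = ft f z - ft g z := by
  simp [ft, sub_mul]

lemma ft_t1 (f : ZMod M × ZMod M → ℂ) (z) :
    ft (fun w => f (w.1 + 1, w.2)) z = ZMod.stdAddChar (-z.1) * ft f z := by
  unfold ft
  rw [Finset.mul_sum]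
  let e : ZMod M × ZMod M ≃ ZMod M × ZMod M := (Equiv.addRight 1).prodCongr (Equiv.refl _)
  refine Fintype.sum_equiv e _ _ fun w => ?_
  have : z.1 * w.1 + z.2 * w.2 = -z.1 + (z.1 * (w.1 + 1) + z.2 * w.2) := by ring
  rw [this, AddChar.map_add_eq_mul]
  simp only [e, Equiv.prodCongr_apply, Prod.map, Equiv.coe_addRight, Equiv.refl_apply]
  ring

lemma ft_t2 (f : ZMod M × ZMod M → ℂ) (z) :
    ft (fun w => f (w.1, w.2 + 1)) z = ZMod.stdAddChar (-z.2) * ft f z := by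
  unfold ft
  rw [Finset.mul_sum]
  let e : ZMod M × ZMod M ≃ ZMod M × ZMod M := (Equiv.refl _).prodCongr (Equiv.addRight 1)
  refine Fintype.sum_equiv e _ _ fun w => ?_
  have : z.1 * w.1 + z.2 * w.2 = -z.2 + (z.1 * w.1 + z.2 * (w.2 + 1)) := by ring
  rw [this, AddChar.map_add_eq_mul]
  simp only [e, Equiv.prodCongr_apply, Prod.map, Equiv.coe_addRight, Equiv.refl_apply]
  ring

/-- shear `(x,y) ↦ (x, y+2x)` -/
def sh2 (M : ℕ) : Equiv.Perm (ZMod M × ZMod M) where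
  toFun w := (w.1, w.2 + 2 * w.1)
  invFun w := (w.1, w.2 - 2 * w.1)
  left_inv w := by ext <;> simp
  right_inv w := by ext <;> simp

/-- shear `(x,y) ↦ (x+2y, y)` -/
def sh1 (M : ℕ) : Equiv.Perm (ZMod M × ZMod M) where
  toFun w := (w.1 + 2 * w.2, w.2)
  invFun w := (w.1 - 2 * w.2, w.2)
  left_inv w := by ext <;> simp
  right_inv w := by ext <;> simp

lemma ft_s2 (f : ZMod M × ZMod M → ℂ) (z) :
    ft (fun w => f (sh2 M w)) z = ft f ((sh1 M).symm z) := by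
  unfold ft
  refine Fintype.sum_equiv (sh2 M) _ _ fun w => ?_
  simp only [sh2, sh1, Equiv.coe_fn_mk, Equiv.coe_fn_symm_mk]
  congr 2; ring

lemma ft_s1 (f : ZMod M × ZMod M → ℂ) (z) :
    ft (fun w => f (sh1 M w)) z = ft f ((sh2 M).symm z) := by
  unfold ft
  refine Fintype.sum_equiv (sh1 M) _ _ fun w => ?_
  simp only [sh2, sh1, Equiv.coe_fn_mk, Equiv.coe_fn_symm_mk]
  congr 2; ring

lemma char_lower (a : ZMod M) (ha : (M : ℤ) < 8 * |a.valMinAbs|) :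
    1 / 4 ≤ ‖(ZMod.stdAddChar (-a) : ℂ) - 1‖ ^ 2 := by
  have hM : (0 : ℝ) < M := by exact_mod_cast Nat.pos_of_ne_zero (NeZero.ne M)
  set j := a.valMinAbs with hj
  have hb := ZMod.valMinAbs_mem_Ioc a
  rw [← hj] at hb
  have hub : 2 * |j| ≤ M := by
    have h1 := hb.1; have h2 := hb.2
    rcases abs_cases j with ⟨h, _⟩ | ⟨h, _⟩ <;> rw [h] <;> omega
  have e1 : (-a) = ((-j : ℤ) : ZMod M) := by push_cast; rw [hj, ZMod.coe_valMinAbs]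
  rw [e1, ZMod.stdAddChar_coe]
  have e2 : (2 * (Real.pi : ℂ) * Complex.I * ((-j : ℤ) : ℂ) / M)
      = Complex.I * ((2 * Real.pi * (-j) / M : ℝ) : ℂ) := by push_cast; ring
  rw [e2, Complex.norm_exp_I_mul_ofReal_sub_one, norm_mul, mul_pow]
  have e3 : 2 * Real.pi * (-(j : ℝ)) / M / 2 = -(Real.pi * j / M) := by ring
  rw [e3, Real.sin_neg, norm_neg]
  have haR : (M : ℝ) < 8 * |(j : ℝ)| := by exact_mod_cast ha
  have hubR : 2 * |(j : ℝ)| ≤ M := by exact_mod_cast hub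
  have h5 : ‖Real.sin (Real.pi * j / M)‖ ^ 2 = Real.sin (Real.pi * |(j : ℝ)| / M) ^ 2 := by
    rw [Real.norm_eq_abs, sq_abs]
    rcases abs_cases (j : ℝ) with ⟨h, _⟩ | ⟨h, _⟩ <;> rw [h]
    have : Real.pi * -(j : ℝ) / M = -(Real.pi * j / M) := by ring
    rw [this, Real.sin_neg]; ring
  have h6 := Real.mul_le_sin (x := Real.pi * |(j : ℝ)| / M) (by positivity) (by
    rw [div_le_div_iff₀ hM (by norm_num)]
    nlinarith [Real.pi_pos])
  have h7 : 2 / Real.pi * (Real.pi * |(j : ℝ)| / M) = 2 * |(j : ℝ)| / M := by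
    field_simp
  rw [h7] at h6
  have h8 : 1 / 4 ≤ 2 * |(j : ℝ)| / M := by
    rw [div_le_div_iff₀ (by norm_num) hM]; linarith
  rw [h5]
  norm_num
  nlinarith


lemma transfer (F : ZMod M × ZMod M → ℂ) (T : Equiv.Perm (ZMod M × ZMod M)) (D : ℝ)
    (hD : ∑ z, ‖F (T z) - F z‖ ^ 2 ≤ D) (A : Finset (ZMod M × ZMod M)) :
    ∑ z ∈ A, ‖F z‖ ^ 2 ≤ 5 / 4 * ∑ z ∈ A.map T.toEmbedding, ‖F z‖ ^ 2 + 5 * D := by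
  rw [Finset.sum_map]
  have h1 : ∀ z, ‖F z‖ ^ 2 ≤ 5 / 4 * ‖F (T z)‖ ^ 2 + 5 * ‖F (T z) - F z‖ ^ 2 := by
    intro z
    have h : ‖F z‖ ≤ ‖F (T z)‖ + ‖F (T z) - F z‖ := by
      have := norm_sub_le (F (T z)) (F (T z) - F z)
      simpa using this
    have h0 := norm_nonneg (F z)
    nlinarith [sq_nonneg (‖F (T z)‖ - 4 * ‖F (T z) - F z‖)]
  calc ∑ z ∈ A, ‖F z‖ ^ 2 ≤ ∑ z ∈ A, (5 / 4 * ‖F (T z)‖ ^ 2 + 5 * ‖F (T z) - F z‖ ^ 2) :=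
        Finset.sum_le_sum fun z _ => h1 z
    _ = 5 / 4 * ∑ z ∈ A, ‖F (T z)‖ ^ 2 + 5 * ∑ z ∈ A, ‖F (T z) - F z‖ ^ 2 := by
        rw [Finset.sum_add_distrib, Finset.mul_sum, Finset.mul_sum]
    _ ≤ _ := by
        have : ∑ z ∈ A, ‖F (T z) - F z‖ ^ 2 ≤ ∑ z, ‖F (T z) - F z‖ ^ 2 :=
          Finset.sum_le_sum_of_subset_of_nonneg (Finset.subset_univ _) (fun _ _ _ => by positivity)
        have e : ∀ z, T.toEmbedding z = T z := fun _ => rfl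
        simp only [e]
        linarith

lemma perm_symm_sum (F : ZMod M × ZMod M → ℂ) (T : Equiv.Perm (ZMod M × ZMod M)) :
    ∑ z, ‖F (T z) - F z‖ ^ 2 = ∑ z, ‖F (T.symm z) - F z‖ ^ 2 := by
  refine Fintype.sum_equiv T _ _ fun z => ?_
  simp [norm_sub_rev]

lemma vma_add (x y : ZMod M) (hx : 8 * |x.valMinAbs| ≤ M) (hy : 8 * |y.valMinAbs| ≤ M) :
    (x + 2 * y).valMinAbs = x.valMinAbs + 2 * y.valMinAbs := by
  have hM : (0 : ℤ) < M := by exact_mod_cast Nat.pos_of_ne_zero (NeZero.ne M)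
  rw [ZMod.valMinAbs_spec]
  refine ⟨by push_cast; simp, ?_⟩
  rw [Set.mem_Ioc]
  have := abs_le.1 (le_refl |x.valMinAbs|)
  have := abs_le.1 (le_refl |y.valMinAbs|)
  constructor <;> omega

lemma vma_sub (x y : ZMod M) (hx : 8 * |x.valMinAbs| ≤ M) (hy : 8 * |y.valMinAbs| ≤ M) :
    (x - 2 * y).valMinAbs = x.valMinAbs - 2 * y.valMinAbs := by
  have hM : (0 : ℤ) < M := by exact_mod_cast Nat.pos_of_ne_zero (NeZero.ne M)
  rw [ZMod.valMinAbs_spec]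
  refine ⟨by push_cast; simp, ?_⟩
  rw [Set.mem_Ioc]
  have := abs_le.1 (le_refl |x.valMinAbs|)
  have := abs_le.1 (le_refl |y.valMinAbs|)
  constructor <;> omega

lemma abs_aux1 (X Y : ℤ) (h : |X| < |Y|) : |Y| < |X + 2 * Y| ∧ |Y| < |X - 2 * Y| := by
  constructor <;> grind

set_option maxHeartbeats 1000000 in
open Classical in
lemma pingpong (F : ZMod M × ZMod M → ℂ) (h0 : F 0 = 0) (D : ℝ)
    (h1 : ∑ z, ‖F (sh1 M z) - F z‖ ^ 2 ≤ D) (h2 : ∑ z, ‖F (sh2 M z) - F z‖ ^ 2 ≤ D)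
    (ho : ∑ z with ¬ (8 * |z.1.valMinAbs| ≤ (M : ℤ) ∧ 8 * |z.2.valMinAbs| ≤ (M : ℤ)), ‖F z‖ ^ 2 ≤ 4 * D) :
    ∑ z, ‖F z‖ ^ 2 ≤ 164 * D := by
  set B : Finset (ZMod M × ZMod M) :=
    Finset.univ.filter (fun z => 8 * |z.1.valMinAbs| ≤ M ∧ 8 * |z.2.valMinAbs| ≤ M) with hB
  set O : Finset (ZMod M × ZMod M) :=
    Finset.univ.filter (fun z => ¬ (8 * |z.1.valMinAbs| ≤ M ∧ 8 * |z.2.valMinAbs| ≤ M)) with hO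
  set P := B.filter (fun z => |z.1.valMinAbs| < |z.2.valMinAbs|) with hP
  set Q := B.filter (fun z => |z.2.valMinAbs| < |z.1.valMinAbs|) with hQ
  set R1 := B.filter (fun z => z.1.valMinAbs = z.2.valMinAbs ∧ z ≠ 0) with hR1
  set R2 := B.filter (fun z => z.1.valMinAbs = - z.2.valMinAbs ∧ z ≠ 0) with hR2
  set e : Finset (ZMod M × ZMod M) → ℝ := fun A => ∑ z ∈ A, ‖F z‖ ^ 2 with he
  have emono : ∀ A A' : Finset (ZMod M × ZMod M), A ⊆ A' → e A ≤ e A' := fun A A' h =>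
    Finset.sum_le_sum_of_subset_of_nonneg h (fun _ _ _ => by positivity)
  have eun : ∀ A A' : Finset (ZMod M × ZMod M), e (A ∪ A') ≤ e A + e A' := fun A A' => by
    have := Finset.sum_union_inter (s₁ := A) (s₂ := A') (f := fun z => ‖F z‖ ^ 2)
    have h : 0 ≤ e (A ∩ A') := Finset.sum_nonneg fun _ _ => by positivity
    simp only [he] at *
    linarith
  have edisj : ∀ A A' : Finset (ZMod M × ZMod M), Disjoint A A' → e (A ∪ A') = e A + e A' :=
    fun A A' h => Finset.sum_union h
  have h1' : ∑ z, ‖F ((sh1 M).symm z) - F z‖ ^ 2 ≤ D := by rw [← perm_symm_sum]; exact h1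
  have h2' : ∑ z, ‖F ((sh2 M).symm z) - F z‖ ^ 2 ≤ D := by rw [← perm_symm_sum]; exact h2
  -- P goes to Q ∪ O
  have p1 : P.map (sh1 M).toEmbedding ⊆ Q ∪ O := by
    intro z hz
    obtain ⟨w, hw, rfl⟩ := Finset.mem_map.1 hz
    simp only [hP, hB, Finset.mem_filter, Finset.mem_univ, true_and] at hw
    have := vma_add w.1 w.2 hw.1.1 hw.1.2
    have h3 := (abs_aux1 _ _ hw.2).1
    simp only [hQ, hO, hB, Finset.mem_union, Finset.mem_filter, Finset.mem_univ, true_and, sh1,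
      Equiv.coe_toEmbedding, Equiv.coe_fn_mk, this]
    tauto
  have p2 : P.map (sh1 M).symm.toEmbedding ⊆ Q ∪ O := by
    intro z hz
    obtain ⟨w, hw, rfl⟩ := Finset.mem_map.1 hz
    simp only [hP, hB, Finset.mem_filter, Finset.mem_univ, true_and] at hw
    have := vma_sub w.1 w.2 hw.1.1 hw.1.2
    have h3 := (abs_aux1 _ _ hw.2).2
    simp only [hQ, hO, hB, Finset.mem_union, Finset.mem_filter, Finset.mem_univ, true_and, sh1,
      Equiv.coe_toEmbedding, Equiv.coe_fn_mk, Equiv.coe_fn_symm_mk, this]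
    tauto
  have p3 : Disjoint (P.map (sh1 M).toEmbedding) (P.map (sh1 M).symm.toEmbedding) := by
    rw [Finset.disjoint_left]
    intro z hz hz'
    obtain ⟨w, hw, rfl⟩ := Finset.mem_map.1 hz
    obtain ⟨w', hw', he⟩ := Finset.mem_map.1 hz'
    simp only [hP, hB, Finset.mem_filter, Finset.mem_univ, true_and] at hw hw'
    simp only [sh1, Equiv.coe_toEmbedding, Equiv.coe_fn_mk, Equiv.coe_fn_symm_mk, Prod.mk.injEq] at he
    have a1 := vma_add w.1 w.2 hw.1.1 hw.1.2
    have a2 := vma_sub w'.1 w'.2 hw'.1.1 hw'.1.2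
    rw [he.1] at a2
    rw [a1, he.2] at a2
    have b1 := hw.2
    have b2 := hw'.2
    rw [he.2] at b2
    grind
  have q1 : Q.map (sh2 M).toEmbedding ⊆ P ∪ O := by
    intro z hz
    obtain ⟨w, hw, rfl⟩ := Finset.mem_map.1 hz
    simp only [hQ, hB, Finset.mem_filter, Finset.mem_univ, true_and] at hw
    have := vma_add w.2 w.1 hw.1.2 hw.1.1
    have h3 := (abs_aux1 _ _ hw.2).1
    simp only [hP, hO, hB, Finset.mem_union, Finset.mem_filter, Finset.mem_univ, true_and, sh2,
      Equiv.coe_toEmbedding, Equiv.coe_fn_mk, this]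
    tauto
  have q2 : Q.map (sh2 M).symm.toEmbedding ⊆ P ∪ O := by
    intro z hz
    obtain ⟨w, hw, rfl⟩ := Finset.mem_map.1 hz
    simp only [hQ, hB, Finset.mem_filter, Finset.mem_univ, true_and] at hw
    have := vma_sub w.2 w.1 hw.1.2 hw.1.1
    have h3 := (abs_aux1 _ _ hw.2).2
    simp only [hP, hO, hB, Finset.mem_union, Finset.mem_filter, Finset.mem_univ, true_and, sh2,
      Equiv.coe_toEmbedding, Equiv.coe_fn_mk, Equiv.coe_fn_symm_mk, this]
    tauto
  have q3 : Disjoint (Q.map (sh2 M).toEmbedding) (Q.map (sh2 M).symm.toEmbedding) := by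
    rw [Finset.disjoint_left]
    intro z hz hz'
    obtain ⟨w, hw, rfl⟩ := Finset.mem_map.1 hz
    obtain ⟨w', hw', he⟩ := Finset.mem_map.1 hz'
    simp only [hQ, hB, Finset.mem_filter, Finset.mem_univ, true_and] at hw hw'
    simp only [sh2, Equiv.coe_toEmbedding, Equiv.coe_fn_mk, Equiv.coe_fn_symm_mk, Prod.mk.injEq] at he
    have a1 := vma_add w.2 w.1 hw.1.2 hw.1.1
    have a2 := vma_sub w'.2 w'.1 hw'.1.2 hw'.1.1
    rw [he.2] at a2
    rw [a1, he.1] at a2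
    have b1 := hw.2
    have b2 := hw'.2
    rw [he.1] at b2
    grind
  have r1 : R1.map (sh1 M).toEmbedding ⊆ Q ∪ O := by
    intro z hz
    obtain ⟨w, hw, rfl⟩ := Finset.mem_map.1 hz
    simp only [hR1, hB, Finset.mem_filter, Finset.mem_univ, true_and] at hw
    have := vma_add w.1 w.2 hw.1.1 hw.1.2
    have h3 : w.2.valMinAbs ≠ 0 := by
      intro h
      apply hw.2.2
      have hx := hw.2.1
      rw [h] at hx
      ext <;> simp [(ZMod.valMinAbs_eq_zero _).1 h, (ZMod.valMinAbs_eq_zero _).1 hx]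
    have h4 : |w.2.valMinAbs| < |w.1.valMinAbs + 2 * w.2.valMinAbs| := by
      rw [hw.2.1]; grind
    simp only [hQ, hO, hB, Finset.mem_union, Finset.mem_filter, Finset.mem_univ, true_and, sh1,
      Equiv.coe_toEmbedding, Equiv.coe_fn_mk, this]
    tauto
  have r2 : R2.map (sh1 M).symm.toEmbedding ⊆ Q ∪ O := by
    intro z hz
    obtain ⟨w, hw, rfl⟩ := Finset.mem_map.1 hz
    simp only [hR2, hB, Finset.mem_filter, Finset.mem_univ, true_and] at hw
    have := vma_sub w.1 w.2 hw.1.1 hw.1.2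
    have h3 : w.2.valMinAbs ≠ 0 := by
      intro h
      apply hw.2.2
      have hx := hw.2.1
      rw [h] at hx
      ext <;> simp [(ZMod.valMinAbs_eq_zero _).1 h, (ZMod.valMinAbs_eq_zero _).1 (hx.trans neg_zero)]
    have h4 : |w.2.valMinAbs| < |w.1.valMinAbs - 2 * w.2.valMinAbs| := by
      rw [hw.2.1]; grind
    simp only [hQ, hO, hB, Finset.mem_union, Finset.mem_filter, Finset.mem_univ, true_and, sh1,
      Equiv.coe_toEmbedding, Equiv.coe_fn_mk, Equiv.coe_fn_symm_mk, this]
    tauto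
  have cover : (Finset.univ : Finset (ZMod M × ZMod M)) ⊆ ((((P ∪ Q) ∪ R1) ∪ R2) ∪ O) ∪ {0} := by
    intro z _
    by_cases hb : z ∈ B
    · by_cases hz : z = 0
      · simp [hz]
      · rcases lt_trichotomy |z.1.valMinAbs| |z.2.valMinAbs| with h | h | h
        · have : z ∈ P := Finset.mem_filter.2 ⟨hb, h⟩
          simp only [Finset.mem_union]; tauto
        · rcases abs_eq_abs.1 h with h' | h'
          · have : z ∈ R1 := Finset.mem_filter.2 ⟨hb, h', hz⟩
            simp only [Finset.mem_union]; tauto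
          · have : z ∈ R2 := Finset.mem_filter.2 ⟨hb, h', hz⟩
            simp only [Finset.mem_union]; tauto
        · have : z ∈ Q := Finset.mem_filter.2 ⟨hb, h⟩
          simp only [Finset.mem_union]; tauto
    · have : z ∈ O := Finset.mem_filter.2 ⟨Finset.mem_univ _, fun h => hb
        (Finset.mem_filter.2 ⟨Finset.mem_univ _, h⟩)⟩
      simp only [Finset.mem_union]; tauto
  have tp1 := transfer F (sh1 M) D h1 P
  have tp2 := transfer F (sh1 M).symm D h1' P
  have tq1 := transfer F (sh2 M) D h2 Q
  have tq2 := transfer F (sh2 M).symm D h2' Q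
  have tr1 := transfer F (sh1 M) D h1 R1
  have tr2 := transfer F (sh1 M).symm D h1' R2
  have c1 := emono _ _ (Finset.union_subset p1 p2)
  rw [edisj _ _ p3] at c1
  have c2 := emono _ _ (Finset.union_subset q1 q2)
  rw [edisj _ _ q3] at c2
  have c3 := emono _ _ r1
  have c4 := emono _ _ r2
  have u1 := eun Q O
  have u2 := eun P O
  have v0 := emono _ _ cover
  have v1 := eun ((((P ∪ Q) ∪ R1) ∪ R2) ∪ O) {0}
  have v2 := eun (((P ∪ Q) ∪ R1) ∪ R2) O
  have v3 := eun ((P ∪ Q) ∪ R1) R2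
  have v4 := eun (P ∪ Q) R1
  have v5 := eun P Q
  have z0 : e {0} = 0 := by simp [he, h0]
  have oo : e O ≤ 4 * D := ho
  change e Finset.univ ≤ _
  change e P ≤ 5 / 4 * e _ + _ at tp1
  change e P ≤ 5 / 4 * e _ + _ at tp2
  change e Q ≤ 5 / 4 * e _ + _ at tq1
  change e Q ≤ 5 / 4 * e _ + _ at tq2
  change e R1 ≤ 5 / 4 * e _ + _ at tr1
  change e R2 ≤ 5 / 4 * e _ + _ at tr2
  have hp0 : 0 ≤ e P := Finset.sum_nonneg fun _ _ => by positivity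
  linarith

lemma gap (f : ZMod M × ZMod M → ℂ) (h0 : ∑ w, f w = 0) :
    ∑ w, ‖f w‖ ^ 2 ≤ 164 * (∑ w, ‖f (w.1 + 1, w.2) - f w‖ ^ 2 + ∑ w, ‖f (w.1, w.2 + 1) - f w‖ ^ 2
      + ∑ w, ‖f (sh1 M w) - f w‖ ^ 2 + ∑ w, ‖f (sh2 M w) - f w‖ ^ 2) := by
  classical
  have hM : (0 : ℝ) < (M : ℝ) ^ 2 := by
    have : (0 : ℝ) < M := by exact_mod_cast Nat.pos_of_ne_zero (NeZero.ne M)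
    positivity
  set d1 := ∑ w, ‖f (w.1 + 1, w.2) - f w‖ ^ 2 with hd1
  set d2 := ∑ w, ‖f (w.1, w.2 + 1) - f w‖ ^ 2 with hd2
  set d3 := ∑ w, ‖f (sh1 M w) - f w‖ ^ 2 with hd3
  set d4 := ∑ w, ‖f (sh2 M w) - f w‖ ^ 2 with hd4
  have n1 : 0 ≤ d1 := Finset.sum_nonneg fun _ _ => by positivity
  have n2 : 0 ≤ d2 := Finset.sum_nonneg fun _ _ => by positivity
  have n3 : 0 ≤ d3 := Finset.sum_nonneg fun _ _ => by positivity
  have n4 : 0 ≤ d4 := Finset.sum_nonneg fun _ _ => by positivity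
  have k1 := plancherel (fun w => f (w.1 + 1, w.2) - f w)
  have k2 := plancherel (fun w => f (w.1, w.2 + 1) - f w)
  have k3 := plancherel (fun w => f (sh1 M w) - f w)
  have k4 := plancherel (fun w => f (sh2 M w) - f w)
  have k := plancherel f
  simp only [ft_sub (fun w => f (w.1 + 1, w.2)) f, ft_t1, ← hd1] at k1
  simp only [ft_sub (fun w => f (w.1, w.2 + 1)) f, ft_t2, ← hd2] at k2
  simp only [ft_sub (fun w => f (sh1 M w)) f, ft_s1, ← hd3] at k3
  simp only [ft_sub (fun w => f (sh2 M w)) f, ft_s2, ← hd4] at k4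
  have main := pingpong (ft f) (by simp [ft, h0]) ((M : ℝ) ^ 2 * (d1 + d2 + d3 + d4))
    (by rw [perm_symm_sum, k4]; nlinarith) (by rw [perm_symm_sum, k3]; nlinarith) (by
      have : ∀ z : ZMod M × ZMod M, (if ¬ (8 * |z.1.valMinAbs| ≤ M ∧ 8 * |z.2.valMinAbs| ≤ M) then
          ‖ft f z‖ ^ 2 else 0) ≤ 4 * (‖ZMod.stdAddChar (-z.1) * ft f z - ft f z‖ ^ 2 +
            ‖ZMod.stdAddChar (-z.2) * ft f z - ft f z‖ ^ 2) := by
        intro z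
        have e1 : ZMod.stdAddChar (-z.1) * ft f z - ft f z = (ZMod.stdAddChar (-z.1) - 1) * ft f z := by ring
        have e2 : ZMod.stdAddChar (-z.2) * ft f z - ft f z = (ZMod.stdAddChar (-z.2) - 1) * ft f z := by ring
        rw [e1, e2, norm_mul, norm_mul, mul_pow, mul_pow]
        have s := sq_nonneg ‖ft f z‖
        split_ifs with hh
        · positivity
        · rw [not_and_or, not_le, not_le] at hh
          have w1 := sq_nonneg ‖(ZMod.stdAddChar (-z.1) : ℂ) - 1‖
          have w2 := sq_nonneg ‖(ZMod.stdAddChar (-z.2) : ℂ) - 1‖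
          rcases hh with hh | hh
          · have := char_lower _ hh
            nlinarith
          · have := char_lower _ hh
            nlinarith
      rw [Finset.sum_filter]
      refine (Finset.sum_le_sum fun z _ => this z).trans ?_
      rw [← Finset.mul_sum, Finset.sum_add_distrib, k1, k2]
      nlinarith)
  rw [k] at main
  have : (M : ℝ) ^ 2 * ∑ w, ‖f w‖ ^ 2 ≤ (M : ℝ) ^ 2 * (164 * (d1 + d2 + d3 + d4)) := by linarith
  exact le_of_mul_le_mul_left this hM

end Fourier

section Sigma
variable {M : ℕ} [NeZero M]

def gens (M : ℕ) : Fin 4 → Equiv.Perm (ZMod M × ZMod M)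
  | 0 => (Equiv.addRight 1).prodCongr (Equiv.refl _)
  | 1 => (Equiv.refl _).prodCongr (Equiv.addRight 1)
  | 2 => sh1 M
  | 3 => sh2 M

def sig0 (M : ℕ) (c : (ZMod M × ZMod M) × (Fin 4 × Bool)) : (ZMod M × ZMod M) × (Fin 4 × Bool) :=
  if c.2.2 then (gens M c.2.1 c.1, (c.2.1, false)) else ((gens M c.2.1).symm c.1, (c.2.1, true))

lemma sig0_inv (c) : sig0 M (sig0 M c) = c := by
  rcases c with ⟨a, i, b⟩
  cases b <;> simp [sig0]

lemma sig0_ne (c) : sig0 M c ≠ c := by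
  rcases c with ⟨a, i, b⟩
  cases b <;> simp [sig0]

open Classical in
lemma sig0_exp (X : Finset (ZMod M × ZMod M)) (hX : 2 * X.card ≤ M ^ 2) :
    (X.card : ℝ) ≤ 328 * ((Finset.univ.filter fun c => c.1 ∈ X ∧ (sig0 M c).1 ∉ X).card : ℝ) := by
  have hM : (0 : ℝ) < (M : ℝ) ^ 2 := by
    have : (0 : ℝ) < M := by exact_mod_cast Nat.pos_of_ne_zero (NeZero.ne M)
    positivity
  set mu : ℝ := X.card / (M : ℝ) ^ 2 with hmu
  set ind : ZMod M × ZMod M → ℝ := fun w => if w ∈ X then 1 else 0 with hind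
  set f : ZMod M × ZMod M → ℂ := fun w => ((ind w - mu : ℝ) : ℂ) with hf
  have hcard : (Fintype.card (ZMod M × ZMod M) : ℝ) = (M : ℝ) ^ 2 := by
    rw [Fintype.card_prod, ZMod.card]; push_cast; ring
  have hsum : ∑ w, ind w = X.card := by simp [hind]
  have hm2 : (M : ℝ) ^ 2 * mu = X.card := by rw [hmu, mul_comm, div_mul_cancel₀ _ hM.ne']
  have h0 : ∑ w, f w = 0 := by
    simp only [hf]
    rw [← Complex.ofReal_sum, Finset.sum_sub_distrib, hsum, Finset.sum_const, Finset.card_univ,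
      nsmul_eq_mul, hcard, hm2]
    simp
  have hg := gap f h0
  have hn : ∑ w, ‖f w‖ ^ 2 = X.card - X.card * mu := by
    have h1 : ∀ w, ‖f w‖ ^ 2 = ind w * (1 - 2 * mu) + mu ^ 2 := by
      intro w
      simp only [hf, Complex.norm_real, Real.norm_eq_abs, sq_abs, hind]
      split_ifs <;> ring
    simp_rw [h1]
    rw [Finset.sum_add_distrib, ← Finset.sum_mul, hsum, Finset.sum_const, Finset.card_univ,
      nsmul_eq_mul, hcard]
    have : (M : ℝ) ^ 2 * mu ^ 2 = X.card * mu := by rw [← hm2]; ring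
    rw [this]; ring
  have hmu2 : mu ≤ 1 / 2 := by
    rw [hmu, div_le_iff₀ hM]
    have : (2 * X.card : ℝ) ≤ (M : ℝ) ^ 2 := by exact_mod_cast hX
    linarith
  have hd : ∀ T : Equiv.Perm (ZMod M × ZMod M), ∑ w, ‖f (T w) - f w‖ ^ 2 =
      ∑ w, ((if w ∈ X ∧ T w ∉ X then (1 : ℝ) else 0) + (if w ∈ X ∧ T.symm w ∉ X then (1 : ℝ) else 0)) := by
    intro T
    rw [Finset.sum_add_distrib]
    have e : ∑ w, (if w ∈ X ∧ T.symm w ∉ X then (1 : ℝ) else 0)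
        = ∑ w, (if T w ∈ X ∧ w ∉ X then (1 : ℝ) else 0) := by
      symm
      refine Fintype.sum_equiv T _ _ fun w => ?_
      simp
    rw [e, ← Finset.sum_add_distrib]
    refine Finset.sum_congr rfl fun w _ => ?_
    simp only [hf, ← Complex.ofReal_sub, Complex.norm_real, Real.norm_eq_abs, sq_abs, hind]
    by_cases h1 : w ∈ X <;> by_cases h2 : T w ∈ X <;> simp [h1, h2] <;> ring_nf <;> simp
  have hc : ((Finset.univ.filter fun c => c.1 ∈ X ∧ (sig0 M c).1 ∉ X).card : ℝ)
      = ∑ i : Fin 4, ∑ w, ‖f (gens M i w) - f w‖ ^ 2 := by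
    rw [Finset.card_filter]
    push_cast
    rw [Fintype.sum_prod_type, Finset.sum_comm, Fintype.sum_prod_type]
    refine Finset.sum_congr rfl fun i _ => ?_
    rw [hd]
    simp only [Fintype.sum_bool, ← Finset.sum_add_distrib]
    refine Finset.sum_congr rfl fun w _ => ?_
    simp [sig0]
  rw [hc, Fin.sum_univ_four]
  have e1 : ∀ w, gens M 0 w = (w.1 + 1, w.2) := fun w => rfl
  have e2 : ∀ w, gens M 1 w = (w.1, w.2 + 1) := fun w => rfl
  have e3 : ∀ w, gens M 2 w = sh1 M w := fun w => rfl
  have e4 : ∀ w, gens M 3 w = sh2 M w := fun w => rfl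
  simp only [e1, e2, e3, e4]
  rw [hn] at hg
  have : (0 : ℝ) ≤ X.card := Nat.cast_nonneg _
  nlinarith

open Classical in
theorem exists_sigma (M N : ℕ) [NeZero M] (hN : N = M ^ 2) :
    ∃ σ : Fin N × Fin 8 → Fin N × Fin 8, (∀ c, σ (σ c) = c) ∧ (∀ c, σ c ≠ c) ∧
      ∀ X : Finset (Fin N), 2 * X.card ≤ N →
        (X.card : ℝ) ≤ 328 * ((Finset.univ.filter fun c => c.1 ∈ X ∧ (σ c).1 ∉ X).card : ℝ) := by
  have e : (ZMod M × ZMod M) ≃ Fin N := Fintype.equivFinOfCardEq (by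
    rw [Fintype.card_prod, ZMod.card, hN, sq])
  have r : (Fin 4 × Bool) ≃ Fin 8 := Fintype.equivFinOfCardEq (by simp)
  let q : (ZMod M × ZMod M) × (Fin 4 × Bool) ≃ Fin N × Fin 8 := e.prodCongr r
  refine ⟨fun c => q (sig0 M (q.symm c)), fun c => by simp [sig0_inv], fun c h => ?_, fun X hX => ?_⟩
  · apply sig0_ne (M := M) (q.symm c)
    apply q.injective
    simpa using h
  · have h := sig0_exp (M := M) (X.map e.symm.toEmbedding) (by rw [Finset.card_map]; omega)
    rw [Finset.card_map] at h
    refine h.trans (le_of_eq ?_)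
    congr 2
    refine Finset.card_bij (fun c _ => q c) ?_ (fun _ _ _ _ h => q.injective h) ?_
    · intro c hc
      simp only [Finset.mem_filter, Finset.mem_univ, true_and, Finset.mem_map_equiv,
        Equiv.symm_symm, Equiv.symm_apply_apply] at hc ⊢
      exact hc
    · intro c hc
      refine ⟨q.symm c, ?_, by simp⟩
      simp only [Finset.mem_filter, Finset.mem_univ, true_and, Finset.mem_map_equiv,
        Equiv.symm_symm] at hc ⊢
      simpa [q] using hc

end Sigma

section Tree

/-- number of leaves below a node of height `h` -/
def gg (t m h : ℕ) : ℕ := 2 ^ (min (h - 8 * t) m) * 3 ^ (h - 8 * t - m)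

lemma gg_pos (t m h : ℕ) : 0 < gg t m h := by unfold gg; positivity

lemma gg_dvd (t m : ℕ) {h h' : ℕ} (hh : h ≤ h') : gg t m h ∣ gg t m h' := by
  unfold gg
  exact mul_dvd_mul (pow_dvd_pow _ (by omega)) (pow_dvd_pow _ (by omega))

lemma gg_low (t m : ℕ) {h : ℕ} (hh : h ≤ 8 * t) : gg t m h = 1 := by
  unfold gg
  have h1 : min (h - 8 * t) m = 0 := by omega
  have h2 : h - 8 * t - m = 0 := by omega
  rw [h1, h2]; norm_num

lemma gg_top (t m : ℕ) : gg t m (8 * t + 2 * m) = 6 ^ m := by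
  unfold gg
  have h1 : min (8 * t + 2 * m - 8 * t) m = m := by omega
  have h2 : 8 * t + 2 * m - 8 * t - m = m := by omega
  rw [h1, h2, ← mul_pow]; norm_num

lemma gg_succ (t m h : ℕ) : gg t m (h + 1) = gg t m h * (if h < 8 * t then 1 else if h < 8 * t + m then 2 else 3) := by
  unfold gg
  split_ifs with h1 h2
  · have e1 : h + 1 - 8 * t = 0 := by omega
    have e2 : h - 8 * t = 0 := by omega
    rw [e1, e2]; simp
  · have e1 : min (h + 1 - 8 * t) m = min (h - 8 * t) m + 1 := by omega
    have e2 : h + 1 - 8 * t - m = h - 8 * t - m := by omega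
    rw [e1, e2, pow_succ]; ring
  · have e1 : min (h + 1 - 8 * t) m = min (h - 8 * t) m := by omega
    have e2 : h + 1 - 8 * t - m = h - 8 * t - m + 1 := by omega
    rw [e1, e2, pow_succ]; ring

lemma gg_two (t m h : ℕ) (hh : 8 * t ≤ h) : 2 * gg t m h ≤ gg t m (h + 1) := by
  rw [gg_succ]
  have := gg_pos t m h
  split_ifs <;> omega

lemma gg_three (t m h : ℕ) : gg t m (h + 1) ≤ 3 * gg t m h := by
  rw [gg_succ]
  have := gg_pos t m h
  split_ifs <;> omega

abbrev VT (t m : ℕ) : Type :=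
  {p : Fin (8 * t + 2 * m + 1) × Fin (6 ^ m) // gg t m p.1.val ∣ p.2.val}

variable {t m : ℕ}

def ht (z : VT t m) : ℕ := z.1.1.val
def xx (z : VT t m) : ℕ := z.1.2.val

lemma ht_le (z : VT t m) : ht z ≤ 8 * t + 2 * m := by
  have := z.1.1.isLt; unfold ht; omega
lemma xx_lt (z : VT t m) : xx z < 6 ^ m := z.1.2.isLt
lemma xx_dvd (z : VT t m) : gg t m (ht z) ∣ xx z := z.2

lemma vt_ext {z z' : VT t m} (h1 : ht z = ht z') (h2 : xx z = xx z') : z = z' :=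
  Subtype.ext (Prod.ext (Fin.ext h1) (Fin.ext h2))

def mkV (h x : ℕ) (hh : h ≤ 8 * t + 2 * m) (hx : x < 6 ^ m) (hd : gg t m h ∣ x) : VT t m :=
  ⟨(⟨h, by omega⟩, ⟨x, hx⟩), hd⟩

@[simp] lemma ht_mkV (h x : ℕ) (hh hx hd) : ht (mkV (t := t) (m := m) h x hh hx hd) = h := rfl
@[simp] lemma xx_mkV (h x : ℕ) (hh hx hd) : xx (mkV (t := t) (m := m) h x hh hx hd) = x := rfl

def up (z z' : VT t m) : Prop :=
  ht z' = ht z + 1 ∧ xx z / gg t m (ht z') = xx z' / gg t m (ht z')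

/-- the node of height `h ≤ 8t` above/below base point `a` -/
def low (h : ℕ) (hh : h ≤ 8 * t) (a : Fin (6 ^ m)) : VT t m :=
  mkV h a.val (by omega) a.isLt (by rw [gg_low t m hh]; exact one_dvd _)

lemma port_le (t : ℕ) (r : Fin 8) : t * r.val ≤ 8 * t := by
  have := r.isLt
  nlinarith

def pos (c : Fin (6 ^ m) × Fin 8) : VT t m := low (t * c.2.val) (port_le t c.2) c.1

@[simp] lemma ht_pos (c : Fin (6 ^ m) × Fin 8) : ht (pos (t := t) c) = t * c.2.val := rfl
@[simp] lemma xx_pos (c : Fin (6 ^ m) × Fin 8) : xx (pos (t := t) c) = c.1.val := rfl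
@[simp] lemma ht_low (h : ℕ) (hh : h ≤ 8 * t) (a : Fin (6 ^ m)) : ht (low h hh a) = h := rfl
@[simp] lemma xx_low (h : ℕ) (hh : h ≤ 8 * t) (a : Fin (6 ^ m)) : xx (low h hh a) = a.val := rfl

lemma pos_inj (h0 : 0 < t) : Function.Injective (pos (t := t) (m := m)) := by
  intro c c' h
  have h1 := congrArg ht h
  have h2 := congrArg xx h
  simp only [ht_pos, xx_pos] at h1 h2
  exact Prod.ext (Fin.ext h2) (Fin.ext (Nat.eq_of_mul_eq_mul_left h0 h1))

lemma port_gap (t : ℕ) (r : Fin 8) : t * r.val + t ≤ 8 * t := by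
  have := r.isLt
  nlinarith

structure Sig (m : ℕ) where
  s : Fin (6 ^ m) × Fin 8 → Fin (6 ^ m) × Fin 8
  inv : ∀ c, s (s c) = c
  ne : ∀ c, s c ≠ c

def GG (h0 : 0 < t) (σ : Sig m) : SimpleGraph (VT t m) where
  Adj z z' := up z z' ∨ up z' z ∨ ∃ c, z = pos c ∧ z' = pos (σ.s c)
  symm := ⟨by
    rintro z z' (h | h | ⟨c, h1, h2⟩)
    · exact Or.inr (Or.inl h)
    · exact Or.inl h
    · exact Or.inr (Or.inr ⟨σ.s c, h2, by rw [σ.inv]; exact h1⟩)⟩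
  loopless := ⟨by
    rintro z (h | h | ⟨c, h1, h2⟩)
    · have := h.1; omega
    · have := h.1; omega
    · exact σ.ne c (pos_inj h0 (h2.symm.trans h1))⟩

lemma div_mono_agree {x y a b : ℕ} (hab : a ∣ b) (h : x / a = y / a) : x / b = y / b := by
  obtain ⟨k, rfl⟩ := hab
  rw [← Nat.div_div_eq_div_mul, ← Nat.div_div_eq_div_mul, h]

lemma div_top (z : VT t m) : xx z / gg t m (8 * t + 2 * m) = 0 := by
  rw [gg_top]; exact Nat.div_eq_of_lt (xx_lt z)

lemma lca_ex (z z' : VT t m) : ∃ H, ht z ≤ H ∧ ht z' ≤ H ∧ xx z / gg t m H = xx z' / gg t m H :=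
  ⟨8 * t + 2 * m, ht_le z, ht_le z', by rw [div_top, div_top]⟩

open Classical in
noncomputable def lca (z z' : VT t m) : ℕ := Nat.find (lca_ex z z')

lemma lca_spec (z z' : VT t m) :
    ht z ≤ lca z z' ∧ ht z' ≤ lca z z' ∧ xx z / gg t m (lca z z') = xx z' / gg t m (lca z z') := by
  classical
  exact Nat.find_spec (lca_ex z z')

lemma lca_le (z z' : VT t m) {H : ℕ} (h1 : ht z ≤ H) (h2 : ht z' ≤ H)
    (h3 : xx z / gg t m H = xx z' / gg t m H) : lca z z' ≤ H := by
  classical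
  exact Nat.find_min' (lca_ex z z') ⟨h1, h2, h3⟩

lemma lca_up1 (z z' z'' : VT t m) (h : up z' z'') : lca z z' ≤ lca z z'' := by
  obtain ⟨a, b, c⟩ := lca_spec z z''
  refine lca_le _ _ a (by have := h.1; omega) ?_
  rw [c]
  exact (div_mono_agree (gg_dvd t m b) h.2).symm

lemma lca_up2 (z z' z'' : VT t m) (h : up z' z'') : lca z z'' ≤ max (lca z z') (ht z'') := by
  obtain ⟨a, b, c⟩ := lca_spec z z'
  refine lca_le _ _ (le_max_of_le_left a) (le_max_right _ _) ?_
  rw [div_mono_agree (gg_dvd t m (le_max_left (lca z z') (ht z''))) c]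
  exact div_mono_agree (gg_dvd t m (le_max_right _ _)) h.2

noncomputable def ker (x : ℝ) (z z' : VT t m) : ℝ :=
  if lca z z' < 8 * t + 2 * m then x ^ ((lca z z' - ht z) + (lca z z' - ht z')) else 0

lemma ker_nonneg {x : ℝ} (hx : 0 ≤ x) (z z' : VT t m) : 0 ≤ ker x z z' := by
  unfold ker; split_ifs <;> positivity

lemma ker_up {x : ℝ} (hx : 0 ≤ x) (hx1 : x ≤ 1) (z z' z'' : VT t m) (h : up z' z'')
    (hr : ht z'' < 8 * t + 2 * m) : x * ker x z z' ≤ ker x z z'' := by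
  have a1 := lca_up1 z z' z'' h
  have a2 := lca_up2 z z' z'' h
  obtain ⟨b1, b2, -⟩ := lca_spec z z'
  obtain ⟨c1, c2, -⟩ := lca_spec z z''
  have d := h.1
  unfold ker
  by_cases h1 : lca z z' < 8 * t + 2 * m
  · have h2 : lca z z'' < 8 * t + 2 * m := lt_of_le_of_lt a2 (max_lt h1 hr)
    rw [if_pos h1, if_pos h2, ← pow_succ']
    refine pow_le_pow_of_le_one hx hx1 ?_
    omega
  · rw [if_neg h1]
    split_ifs <;> simp <;> positivity

lemma ker_down {x : ℝ} (hx : 0 ≤ x) (hx1 : x ≤ 1) (z z' z'' : VT t m) (h : up z' z'') :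
    x * ker x z z'' ≤ ker x z z' := by
  have a1 := lca_up1 z z' z'' h
  obtain ⟨b1, b2, -⟩ := lca_spec z z'
  obtain ⟨c1, c2, -⟩ := lca_spec z z''
  have d := h.1
  unfold ker
  by_cases h1 : lca z z'' < 8 * t + 2 * m
  · have h2 : lca z z' < 8 * t + 2 * m := by omega
    rw [if_pos h1, if_pos h2, ← pow_succ']
    refine pow_le_pow_of_le_one hx hx1 ?_
    omega
  · rw [if_neg h1]
    split_ifs <;> simp <;> positivity

lemma ker_self (x : ℝ) (z : VT t m) (h : ht z < 8 * t + 2 * m) : ker x z z = 1 := by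
  have a := lca_le z z le_rfl le_rfl rfl
  have b := (lca_spec z z).1
  have : lca z z = ht z := le_antisymm a b
  unfold ker
  rw [this, if_pos h]; simp

/-- iterated weights of arrivals through ports -/
noncomputable def wt (x : ℝ) (σ : Sig m) (u : VT t m) : ℕ → Fin (6 ^ m) × Fin 8 → ℝ
  | 0, _ => 0
  | n + 1, c => x * (ker x u (pos (σ.s c)) + ∑ c', wt x σ u n c' * ker x (pos c') (pos (t := t) (σ.s c)))

noncomputable def Phi (x : ℝ) (σ : Sig m) (u : VT t m) (n : ℕ) (z : VT t m) : ℝ :=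
  ker x u z + ∑ c, wt x σ u n c * ker x (pos c) z

lemma wt_succ (x : ℝ) (σ : Sig m) (u : VT t m) (n c) :
    wt x σ u (n + 1) c = x * Phi x σ u n (pos (σ.s c)) := rfl

lemma wt_nonneg {x : ℝ} (hx : 0 ≤ x) (σ : Sig m) (u : VT t m) (n c) : 0 ≤ wt x σ u n c := by
  induction n generalizing c with
  | zero => simp [wt]
  | succ n ih =>
    rw [wt_succ]
    refine mul_nonneg hx (add_nonneg (ker_nonneg hx _ _) (Finset.sum_nonneg fun c' _ =>
      mul_nonneg (ih c') (ker_nonneg hx _ _)))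

lemma Phi_mono_of {x : ℝ} (hx : 0 ≤ x) (σ : Sig m) (u : VT t m) (n n' : ℕ)
    (h : ∀ c, wt x σ u n c ≤ wt x σ u n' c) (z) : Phi x σ u n z ≤ Phi x σ u n' z := by
  unfold Phi
  have : ∑ c, wt x σ u n c * ker x (pos c) z ≤ ∑ c, wt x σ u n' c * ker x (pos c) z :=
    Finset.sum_le_sum fun c _ => mul_le_mul_of_nonneg_right (h c) (ker_nonneg hx _ _)
  linarith

lemma wt_mono {x : ℝ} (hx : 0 ≤ x) (σ : Sig m) (u : VT t m) (n c) :
    wt x σ u n c ≤ wt x σ u (n + 1) c := by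
  induction n generalizing c with
  | zero => exact (wt_nonneg hx σ u 1 c)
  | succ n ih =>
    rw [wt_succ, wt_succ]
    exact mul_le_mul_of_nonneg_left (Phi_mono_of hx σ u _ _ ih _) hx

lemma Phi_mono {x : ℝ} (hx : 0 ≤ x) (σ : Sig m) (u : VT t m) (z) :
    Monotone (fun n => Phi x σ u n z) :=
  monotone_nat_of_le_succ fun n => Phi_mono_of hx σ u _ _ (wt_mono hx σ u n) z

lemma Phi_step {x : ℝ} (hx : 0 ≤ x) (hx1 : x ≤ 1) (h0 : 0 < t) (σ : Sig m) (u : VT t m) (n : ℕ)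
    (z z' : VT t m) (h : (GG h0 σ).Adj z z') (hz : ht z < 8 * t + 2 * m) :
    x * Phi x σ u n z' ≤ Phi x σ u (n + 1) z := by
  have gen : (∀ v, x * ker x v z' ≤ ker x v z) → x * Phi x σ u n z' ≤ Phi x σ u (n + 1) z := by
    intro hv
    refine le_trans ?_ (Phi_mono hx σ u z (Nat.le_succ n))
    simp only [Phi]
    rw [mul_add, Finset.mul_sum]
    refine add_le_add (hv u) (Finset.sum_le_sum fun c _ => ?_)
    have := mul_le_mul_of_nonneg_left (hv (pos c)) (wt_nonneg hx σ u n c)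
    linarith
  rcases h with h | h | ⟨c, h1, h2⟩
  · exact gen fun v => ker_down hx hx1 v z z' h
  · exact gen fun v => ker_up hx hx1 v z' z h hz
  · have e1 : wt x σ u (n + 1) c = x * Phi x σ u n z' := by rw [wt_succ, ← h2]
    rw [← e1]
    have hk : ker x (pos c) z = 1 := by rw [h1]; exact ker_self x _ (h1 ▸ hz)
    have : wt x σ u (n + 1) c * ker x (pos c) z ≤ ∑ c, wt x σ u (n + 1) c * ker x (pos c) z :=
      Finset.single_le_sum (f := fun c => wt x σ u (n + 1) c * ker x (pos c) z)
        (fun c _ => mul_nonneg (wt_nonneg hx σ u _ c) (ker_nonneg hx _ _)) (Finset.mem_univ c)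
    rw [hk, mul_one] at this
    unfold Phi
    linarith [ker_nonneg hx u z]

lemma walk_bound {x : ℝ} (hx : 0 ≤ x) (hx1 : x ≤ 1) (h0 : 0 < t) (σ : Sig m) (u z : VT t m)
    (p : (GG h0 σ).Walk z u) (hp : ∀ v ∈ p.support, ht v < 8 * t + 2 * m) :
    x ^ p.length ≤ Phi x σ u p.length z := by
  induction p with
  | nil =>
    rename_i v
    have : ker x v v = 1 := ker_self x v (hp v (by simp))
    simp [Phi, wt, this]
  | cons h p ih =>
    rw [Walk.length_cons, pow_succ']
    have h1 := ih (fun v hv => hp v (by simp [hv]))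
    refine le_trans (mul_le_mul_of_nonneg_left h1 hx) ?_
    exact Phi_step hx hx1 h0 σ _ _ _ _ h (hp _ (by simp))

end Tree

section Sums
variable {t m : ℕ}

noncomputable def Kb (t m : ℕ) (x : ℝ) (a b : ℕ) : ℝ :=
  ∑ j ∈ Finset.range (2 * m), if a / gg t m (8 * t + j) = b / gg t m (8 * t + j) then x ^ (2 * j) else 0

lemma Kb_nonneg {x : ℝ} (hx : 0 ≤ x) (a b : ℕ) : 0 ≤ Kb t m x a b := by
  unfold Kb
  refine Finset.sum_nonneg fun j _ => ?_
  split_ifs <;> positivity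

lemma card_fiber (N g a : ℕ) (hg : 0 < g) :
    (Finset.univ.filter fun b : Fin N => a / g = b.val / g).card ≤ g := by
  have : (Finset.univ.filter fun b : Fin N => a / g = b.val / g).card ≤ (Finset.range g).card := by
    refine Finset.card_le_card_of_injOn (fun b => b.val % g) ?_ ?_
    · intro b _
      simpa using Nat.mod_lt _ hg
    · intro b hb b' hb' h
      simp only [Finset.coe_filter, Finset.mem_univ, true_and, Set.mem_setOf_eq] at hb hb' h
      apply Fin.ext
      rw [← Nat.div_add_mod b.val g, ← Nat.div_add_mod b'.val g, h, ← hb, ← hb']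
  simpa using this

lemma geom_bound (q : ℝ) (h0 : 0 ≤ q) (h1 : q ≤ 82 / 100) (n : ℕ) :
    ∑ j ∈ Finset.range n, q ^ j ≤ 100 / 18 := by
  have h := mul_neg_geom_sum q n
  have h2 : 0 ≤ q ^ n := pow_nonneg h0 n
  have h3 : 0 ≤ ∑ j ∈ Finset.range n, q ^ j := Finset.sum_nonneg fun _ _ => by positivity
  nlinarith

lemma rho_bound {x : ℝ} (hx : 0 < x) (hx4 : x ^ 4 = 1 / 6) :
    ∑ j ∈ Finset.range (2 * m), (gg t m (8 * t + j) : ℝ) * x ^ (2 * j) ≤ 12 := by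
  set q := 2 * x ^ 2 with hq
  have hq0 : 0 ≤ q := by positivity
  have hq1 : q ≤ 82 / 100 := by
    by_contra h
    push Not at h
    have : x ^ 4 = (q / 2) ^ 2 := by rw [hq]; ring
    nlinarith
  have hq2 : 3 * x ^ 2 * q = 1 := by rw [hq]; linarith [show 3 * x ^ 2 * (2 * x ^ 2) = 6 * x ^ 4 by ring]
  rw [two_mul, Finset.sum_range_add]
  have h1 : ∑ j ∈ Finset.range m, (gg t m (8 * t + j) : ℝ) * x ^ (2 * j) = ∑ j ∈ Finset.range m, q ^ j := by
    refine Finset.sum_congr rfl fun j hj => ?_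
    have hj' := Finset.mem_range.1 hj
    unfold gg
    have e1 : min (8 * t + j - 8 * t) m = j := by omega
    have e2 : 8 * t + j - 8 * t - m = 0 := by omega
    rw [e1, e2, hq]; push_cast
    rw [mul_pow, pow_mul]; ring
  have h2 : ∑ i ∈ Finset.range m, (gg t m (8 * t + (m + i)) : ℝ) * x ^ (2 * (m + i))
      = ∑ j ∈ Finset.range m, q * q ^ j := by
    rw [← Finset.sum_range_reflect]
    refine Finset.sum_congr rfl fun j hj => ?_
    have hj' := Finset.mem_range.1 hj
    unfold gg
    have e1 : min (8 * t + (m + (m - 1 - j)) - 8 * t) m = m := by omega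
    have e2 : 8 * t + (m + (m - 1 - j)) - 8 * t - m = m - 1 - j := by omega
    rw [e1, e2]; push_cast
    have e3 : (2 : ℝ) ^ m * 3 ^ (m - 1 - j) * x ^ (2 * (m + (m - 1 - j)))
        = q ^ m * (3 * x ^ 2) ^ (m - 1 - j) := by
      rw [hq, mul_pow, mul_pow, ← pow_mul, ← pow_mul, mul_add, pow_add]; ring
    rw [e3]
    have e4 : q ^ m = q ^ (m - 1 - j) * q ^ (j + 1) := by rw [← pow_add]; congr 1; omega
    rw [e4]
    have e5 : q ^ (m - 1 - j) * q ^ (j + 1) * (3 * x ^ 2) ^ (m - 1 - j)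
      = (3 * x ^ 2 * q) ^ (m - 1 - j) * q ^ (j + 1) := by rw [mul_pow _ q]; ring
    rw [e5, hq2, one_pow, one_mul, pow_succ']
  rw [h1, h2, ← Finset.mul_sum]
  have := geom_bound q hq0 hq1 m
  have h3 : 0 ≤ ∑ j ∈ Finset.range m, q ^ j := Finset.sum_nonneg fun _ _ => by positivity
  nlinarith

lemma Kb_sum {x : ℝ} (hx : 0 < x) (hx4 : x ^ 4 = 1 / 6) (a : ℕ) :
    ∑ b : Fin (6 ^ m), Kb t m x a b.val ≤ 12 := by
  unfold Kb
  rw [Finset.sum_comm]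
  refine le_trans (Finset.sum_le_sum fun j _ => ?_) (rho_bound (t := t) (m := m) hx hx4)
  rw [← Finset.sum_filter, Finset.sum_const, nsmul_eq_mul]
  refine mul_le_mul_of_nonneg_right ?_ (by positivity)
  exact_mod_cast card_fiber _ _ _ (gg_pos _ _ _)

lemma ker_high {x : ℝ} (hx : 0 ≤ x) (hx1 : x ≤ 1) (z z' : VT t m) (hl : 8 * t ≤ lca z z')
    (s : ℕ) (hs : s + ht z + ht z' ≤ 16 * t) (h1 : ht z ≤ 8 * t) (h2 : ht z' ≤ 8 * t) :
    ker x z z' ≤ x ^ s * Kb t m x (xx z) (xx z') := by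
  unfold ker
  split_ifs with h
  · obtain ⟨-, -, c⟩ := lca_spec z z'
    obtain ⟨j, hj⟩ := Nat.exists_eq_add_of_le hl
    have hk : x ^ (2 * j) ≤ Kb t m x (xx z) (xx z') := by
      unfold Kb
      have := Finset.single_le_sum (f := fun j => if xx z / gg t m (8 * t + j) = xx z' / gg t m (8 * t + j)
        then x ^ (2 * j) else 0) (s := Finset.range (2 * m)) (fun j _ => by split_ifs <;> positivity)
        (Finset.mem_range.2 (show j < 2 * m by omega))
      rw [hj] at c
      simpa only [c, if_true] using this
    refine le_trans ?_ (mul_le_mul_of_nonneg_left hk (by positivity))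
    rw [← pow_add]
    exact pow_le_pow_of_le_one hx hx1 (by omega)
  · exact mul_nonneg (by positivity) (Kb_nonneg hx _ _)

lemma lca_high (z z' : VT t m) (h : xx z ≠ xx z') : 8 * t ≤ lca z z' := by
  by_contra hh
  push Not at hh
  obtain ⟨-, -, c⟩ := lca_spec z z'
  rw [gg_low t m hh.le] at c
  simp at c
  exact h c

def base (a : Fin (6 ^ m)) : VT t m := low (8 * t) le_rfl a

lemma sum_u {x : ℝ} (hx : 0 < x) (hx1 : x ≤ 1) (hx4 : x ^ 4 = 1 / 6) (a : Fin (6 ^ m)) :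
    ∑ c, ker x (base (t := t) a) (pos c) ≤ 96 * x ^ t := by
  rw [Fintype.sum_prod_type, Finset.sum_comm]
  have : ∀ r : Fin 8, ∑ b : Fin (6 ^ m), ker x (base (t := t) a) (pos (b, r)) ≤ 12 * x ^ t := by
    intro r
    have h1 : ∀ b : Fin (6 ^ m), ker x (base (t := t) a) (pos (b, r)) ≤ x ^ t * Kb t m x a.val b.val := by
      intro b
      refine ker_high hx.le hx1 (base (t := t) a) (pos (b, r)) (lca_spec (base (t := t) a) (pos (b, r))).1 t ?_ le_rfl (port_le t r)
      have := port_gap t r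
      simp [base]; omega
    refine (Finset.sum_le_sum fun b _ => h1 b).trans ?_
    rw [← Finset.mul_sum]
    have := Kb_sum (t := t) (m := m) hx hx4 a.val
    nlinarith [pow_pos hx t]
  refine (Finset.sum_le_sum fun r _ => this r).trans ?_
  simp; linarith

lemma sum_v {x : ℝ} (hx : 0 < x) (hx1 : x ≤ 1) (hx4 : x ^ 4 = 1 / 6) (c : Fin (6 ^ m) × Fin 8) :
    ∑ b, ker x (pos (t := t) c) (base b) ≤ 12 := by
  have h1 : ∀ b : Fin (6 ^ m), ker x (pos (t := t) c) (base b) ≤ x ^ 0 * Kb t m x c.1.val b.val := by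
    intro b
    refine ker_high hx.le hx1 (pos (t := t) c) (base b) (lca_spec (pos (t := t) c) (base b)).2.1 0 ?_ (port_le t _) le_rfl
    have := port_gap t c.2
    simp [base]; omega
  refine (Finset.sum_le_sum fun b _ => h1 b).trans ?_
  simp only [pow_zero, one_mul]
  exact Kb_sum hx hx4 _

lemma ker_pp {x : ℝ} (hx : 0 < x) (hx1 : x ≤ 1) (c c' : Fin (6 ^ m) × Fin 8) :
    ker x (pos (t := t) c) (pos c') ≤ (if c' = c then 1 else 0) + (if c'.1 = c.1 then x ^ t else 0)
      + x ^ t * Kb t m x c.1.val c'.1.val := by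
  have k0 : 0 ≤ x ^ t * Kb t m x c.1.val c'.1.val := mul_nonneg (by positivity) (Kb_nonneg hx.le _ _)
  have k1 : (0 : ℝ) ≤ if c'.1 = c.1 then x ^ t else 0 := by split_ifs <;> positivity
  by_cases h : c' = c
  · rw [if_pos h]
    have : ker x (pos (t := t) c) (pos c') ≤ 1 := by
      unfold ker; split_ifs
      · exact pow_le_one₀ hx.le hx1
      · norm_num
    linarith
  · by_cases h1 : c'.1 = c.1
    · rw [if_neg h, if_pos h1]
      have : ker x (pos (t := t) c) (pos c') ≤ x ^ t := by
        unfold ker; split_ifs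
        · refine pow_le_pow_of_le_one hx.le hx1 ?_
          obtain ⟨a, b, -⟩ := lca_spec (pos (t := t) c) (pos c')
          simp only [ht_pos] at a b ⊢
          have hne : c'.2.val ≠ c.2.val := fun hh => h (Prod.ext h1 (Fin.ext hh))
          rcases lt_or_gt_of_ne hne with hl | hl
          · have : t * (c'.2.val + 1) ≤ t * c.2.val := Nat.mul_le_mul_left _ hl
            rw [mul_add] at this
            omega
          · have : t * (c.2.val + 1) ≤ t * c'.2.val := Nat.mul_le_mul_left _ hl
            rw [mul_add] at this
            omega
        · positivity
      linarith
    · rw [if_neg h, if_neg h1]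
      have := ker_high hx.le hx1 (pos (t := t) c) (pos c')
        (lca_high _ _ (by simp only [xx_pos]; exact fun hh => h1 (Fin.ext hh.symm))) t
        (by have := port_gap t c.2; have := port_gap t c'.2; simp only [ht_pos]; omega) (port_le t _) (port_le t _)
      simp only [xx_pos] at this
      linarith

lemma sum_c {x : ℝ} (hx : 0 < x) (hx1 : x ≤ 1) (hx4 : x ^ 4 = 1 / 6) (c : Fin (6 ^ m) × Fin 8) :
    ∑ c', ker x (pos (t := t) c) (pos c') ≤ 1 + 104 * x ^ t := by
  refine (Finset.sum_le_sum fun c' _ => ker_pp hx hx1 c c').trans ?_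
  rw [Finset.sum_add_distrib, Finset.sum_add_distrib]
  have e1 : ∑ c' : Fin (6 ^ m) × Fin 8, (if c' = c then (1 : ℝ) else 0) = 1 := by simp
  have e2 : ∑ c' : Fin (6 ^ m) × Fin 8, (if c'.1 = c.1 then x ^ t else 0) = 8 * x ^ t := by
    rw [Fintype.sum_prod_type, Finset.sum_comm]
    simp
  have e3 : ∑ c' : Fin (6 ^ m) × Fin 8, x ^ t * Kb t m x c.1.val c'.1.val ≤ 96 * x ^ t := by
    rw [← Finset.mul_sum, Fintype.sum_prod_type, Finset.sum_comm]
    have := Kb_sum (t := t) (m := m) hx hx4 c.1.val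
    simp only [Finset.sum_const, Finset.card_univ, Fintype.card_fin, nsmul_eq_mul]
    have h := pow_pos hx t
    push_cast
    nlinarith
  linarith

lemma wt_sum {x : ℝ} (hx : 0 < x) (hx1 : x ≤ 2 / 3) (hx4 : x ^ 4 = 1 / 6) (hxt : x ^ t ≤ 1 / 14040)
    (σ : Sig m) (a : Fin (6 ^ m)) (n : ℕ) : ∑ c, wt x σ (base (t := t) a) n c ≤ 1 / 72 := by
  have hx1' : x ≤ 1 := by linarith
  induction n with
  | zero => simp [wt]
  | succ n ih =>
    simp only [wt_succ]
    rw [← Finset.mul_sum]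
    have e : ∑ c, Phi x σ (base (t := t) a) n (pos (σ.s c)) = ∑ c, Phi x σ (base (t := t) a) n (pos c) :=
      Fintype.sum_equiv ⟨σ.s, σ.s, σ.inv, σ.inv⟩ _ _ fun c => rfl
    rw [e]
    unfold Phi
    rw [Finset.sum_add_distrib, Finset.sum_comm]
    have h1 := sum_u (t := t) hx hx1' hx4 a
    have h2 : ∑ c', ∑ c, wt x σ (base (t := t) a) n c' * ker x (pos (t := t) c') (pos c)
        ≤ ∑ c', wt x σ (base (t := t) a) n c' * (1 + 104 * x ^ t) := by
      refine Finset.sum_le_sum fun c' _ => ?_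
      rw [← Finset.mul_sum]
      exact mul_le_mul_of_nonneg_left (sum_c hx hx1' hx4 c') (wt_nonneg hx.le σ _ n c')
    rw [← Finset.sum_mul] at h2
    have h3 : 0 ≤ ∑ c', wt x σ (base (t := t) a) n c' :=
      Finset.sum_nonneg fun c' _ => wt_nonneg hx.le σ _ n c'
    set W := ∑ c', wt x σ (base (t := t) a) n c'
    have hp := pow_pos hx t
    have h4 : W * (1 + 104 * x ^ t) ≤ 1 / 72 * (1 + 104 * x ^ t) :=
      mul_le_mul_of_nonneg_right ih (by positivity)
    have h5 : ∑ i, ker x (base (t := t) a) (pos i) + ∑ c', ∑ c, wt x σ (base (t := t) a) n c' * ker x (pos (t := t) c') (pos c)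
      ≤ 1 / 48 := by linarith
    have h6 := mul_le_mul_of_nonneg_left h5 hx.le
    linarith

end Sums

section Basic
variable {t m : ℕ}

lemma up_right_unique {z a b : VT t m} (ha : up z a) (hb : up z b) : a = b := by
  have h1 : ht a = ht b := by rw [ha.1, hb.1]
  refine vt_ext h1 ?_
  have h2 : xx a / gg t m (ht a) = xx b / gg t m (ht a) := by
    have := hb.2
    rw [← h1] at this
    exact ha.2.symm.trans this
  obtain ⟨k, hk⟩ := xx_dvd a
  obtain ⟨l, hl⟩ := xx_dvd b
  rw [← h1] at hl
  rw [hk, hl, Nat.mul_div_cancel_left _ (gg_pos _ _ _), Nat.mul_div_cancel_left _ (gg_pos _ _ _)] at h2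
  rw [hk, hl, h2]

def rr (t m h : ℕ) : ℕ := if h < 8 * t then 1 else if h < 8 * t + m then 2 else 3

lemma rr_pos (t m h : ℕ) : 0 < rr t m h := by unfold rr; split_ifs <;> norm_num

lemma rr_le (t m h : ℕ) : rr t m h ≤ 3 := by unfold rr; split_ifs <;> norm_num

lemma gg_succ_rr (t m h : ℕ) : gg t m (h + 1) = gg t m h * rr t m h := gg_succ t m h

lemma children_card (z : VT t m) : {z' : VT t m | up z' z}.ncard ≤ rr t m (ht z - 1) := by
  have : {z' : VT t m | up z' z}.ncard ≤ (Set.Iio (rr t m (ht z - 1))).ncard := by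
    refine Set.ncard_le_ncard_of_injOn (fun z' => xx z' / gg t m (ht z - 1) % rr t m (ht z - 1)) ?_ ?_
      (Set.finite_Iio _)
    · intro z' _
      exact Nat.mod_lt _ (rr_pos _ _ _)
    · intro a ha b hb h
      simp only [Set.mem_ofPred_eq] at ha hb h
      have e1 : ht a = ht z - 1 := by have := ha.1; omega
      have e2 : ht b = ht z - 1 := by have := hb.1; omega
      refine vt_ext (e1.trans e2.symm) ?_
      have e3 : ht z = ht z - 1 + 1 := by have := ha.1; omega
      have h2 := ha.2.trans hb.2.symm
      rw [e3, gg_succ_rr, ← Nat.div_div_eq_div_mul, ← Nat.div_div_eq_div_mul] at h2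
      have h3 : xx a / gg t m (ht z - 1) = xx b / gg t m (ht z - 1) := by
        rw [← Nat.div_add_mod (xx a / gg t m (ht z - 1)) (rr t m (ht z - 1)), h2, h, Nat.div_add_mod]
      have da := xx_dvd a
      have db := xx_dvd b
      rw [e1] at da
      rw [e2] at db
      rw [← Nat.div_mul_cancel da, ← Nat.div_mul_cancel db, h3]
  refine this.trans ?_
  rw [← Nat.card_coe_set_eq]
  simp

lemma deg_le (h0 : 0 < t) (σ : Sig m) (z : VT t m) : ((GG h0 σ).neighborSet z).ncard ≤ 4 := by
  have hsub : (GG h0 σ).neighborSet z ⊆ {z' | up z z'} ∪ ({z' | up z' z} ∪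
      {z' | ∃ c, z = pos c ∧ z' = pos (σ.s c)}) := by
    rintro z' (h | h | h)
    · exact Or.inl h
    · exact Or.inr (Or.inl h)
    · exact Or.inr (Or.inr h)
  have h1 : {z' | up z z'}.ncard ≤ 1 := by
    rw [Set.ncard_le_one]
    intro a ha b hb
    exact up_right_unique ha hb
  have h2 := children_card z
  have h3 : {z' : VT t m | ∃ c, z = pos c ∧ z' = pos (σ.s c)}.ncard ≤ 1 := by
    rw [Set.ncard_le_one]
    rintro a ⟨c, hc, rfl⟩ b ⟨c', hc', rfl⟩
    rw [pos_inj h0 (hc.symm.trans hc')]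
  have h4 := Set.ncard_le_ncard hsub (Set.toFinite _)
  have h5 := Set.ncard_union_le {z' | up z z'} ({z' | up z' z} ∪
      {z' : VT t m | ∃ c, z = pos c ∧ z' = pos (σ.s c)})
  have h6 := Set.ncard_union_le {z' | up z' z}
      {z' : VT t m | ∃ c, z = pos c ∧ z' = pos (σ.s c)}
  by_cases hz : ht z ≤ 8 * t
  · have : rr t m (ht z - 1) = 1 := by
      unfold rr; rw [if_pos (by omega)]
    omega
  · have h7 : {z' : VT t m | ∃ c, z = pos c ∧ z' = pos (σ.s c)} = ∅ := by
      ext z'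
      simp only [Set.mem_ofPred_eq, Set.mem_empty_iff_false, iff_false]
      rintro ⟨c, rfl, -⟩
      exact hz (port_le t c.2)
    rw [h7, Set.ncard_empty] at h6
    rw [h7] at h4 h5
    have := rr_le t m (ht z - 1)
    omega

def root : VT t m := mkV (8 * t + 2 * m) 0 le_rfl (by positivity) (dvd_zero _)

lemma eq_root (z : VT t m) (h : ht z = 8 * t + 2 * m) : z = root := by
  refine vt_ext h ?_
  have := xx_dvd z
  rw [h, gg_top] at this
  exact Nat.eq_zero_of_dvd_of_lt this (xx_lt z)

lemma exists_up (z : VT t m) (h : ht z < 8 * t + 2 * m) : ∃ z', up z z' := by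
  refine ⟨mkV (ht z + 1) (gg t m (ht z + 1) * (xx z / gg t m (ht z + 1))) h
    (lt_of_le_of_lt (Nat.mul_div_le _ _) (xx_lt z)) (dvd_mul_right _ _), rfl, ?_⟩
  simp only [ht_mkV, xx_mkV]
  rw [Nat.mul_div_cancel_left _ (gg_pos _ _ _)]

lemma walk_root (h0 : 0 < t) (σ : Sig m) (k : ℕ) (z : VT t m) (h : ht z + k = 8 * t + 2 * m) :
    ∃ p : (GG h0 σ).Walk z root, p.length = k := by
  induction k generalizing z with
  | zero =>
    have := eq_root z h
    subst this
    exact ⟨Walk.nil, rfl⟩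
  | succ k ih =>
    obtain ⟨z', hz'⟩ := exists_up z (by omega)
    obtain ⟨p, hp⟩ := ih z' (by rw [hz'.1]; omega)
    have hadj : (GG h0 σ).Adj z z' := Or.inl hz'
    exact ⟨Walk.cons hadj p, by rw [Walk.length_cons, hp]⟩

lemma GG_conn (h0 : 0 < t) (σ : Sig m) : (GG h0 σ).Connected := by
  have h : ∀ z, (GG h0 σ).Reachable z root := fun z => by
    obtain ⟨p, -⟩ := walk_root h0 σ (8 * t + 2 * m - ht z) z (by have := ht_le z; omega)
    exact ⟨p⟩
  have : Nonempty (VT t m) := ⟨root⟩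
  exact ⟨fun a b => (h a).trans (h b).symm⟩

lemma dist_base (h0 : 0 < t) (σ : Sig m) (a b : Fin (6 ^ m)) :
    (GG h0 σ).dist (base b) (base a) ≤ 4 * m := by
  obtain ⟨p, hp⟩ := walk_root h0 σ (2 * m) (base b) rfl
  obtain ⟨q, hq⟩ := walk_root h0 σ (2 * m) (base a) rfl
  have := dist_le (p.append q.reverse)
  rw [Walk.length_append, Walk.length_reverse] at this
  omega

end Basic

section Congestion
variable {t m : ℕ}

lemma ker_base_zero (hm : 1 ≤ m) (x : ℝ) (a b : Fin (6 ^ m))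
    (h : a.val / gg t m (8 * t + 2 * m - 1) ≠ b.val / gg t m (8 * t + 2 * m - 1)) :
    ker x (base (t := t) a) (base b) = 0 := by
  unfold ker
  refine if_neg fun hl => h ?_
  obtain ⟨-, -, c⟩ := lca_spec (base (t := t) a) (base b)
  exact div_mono_agree (gg_dvd t m (show lca (base (t := t) a) (base b) ≤ 8 * t + 2 * m - 1 by omega)) c

open Classical in
lemma bad_card (h0 : 0 < t) (hm : 1 ≤ m) (σ : Sig m) {x : ℝ} (hx : 0 < x) (hx1 : x ≤ 2 / 3)
    (hx4 : x ^ 4 = 1 / 6) (hxt : x ^ t ≤ 1 / 14040) (a : Fin (6 ^ m)) :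
    ((Finset.univ.filter fun b : Fin (6 ^ m) => ∃ p : (GG h0 σ).Walk (base b) (base a),
      p.length ≤ 4 * m ∧ root ∉ p.support).card : ℝ) ≤ (6 : ℝ) ^ m / 2 := by
  have hx1' : x ≤ 1 := by linarith
  set g := gg t m (8 * t + 2 * m - 1) with hg
  have hg3 : 3 * g = 6 ^ m := by
    have h1 := gg_succ t m (8 * t + 2 * m - 1)
    rw [show 8 * t + 2 * m - 1 + 1 = 8 * t + 2 * m by omega, gg_top, if_neg (by omega)] at h1
    by_cases h2 : 8 * t + 2 * m - 1 < 8 * t + m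
    · omega
    · rw [if_neg h2] at h1; omega
  set A := Finset.univ.filter fun b : Fin (6 ^ m) => a.val / g = b.val / g with hA
  set B := Finset.univ.filter fun b : Fin (6 ^ m) =>
    (6 ^ m : ℝ)⁻¹ ≤ ∑ c, wt x σ (base (t := t) a) (4 * m) c * ker x (pos (t := t) c) (base b) with hB
  have hsub : (Finset.univ.filter fun b : Fin (6 ^ m) => ∃ p : (GG h0 σ).Walk (base b) (base a),
      p.length ≤ 4 * m ∧ root ∉ p.support) ⊆ A ∪ B := by
    intro b hb
    rw [Finset.mem_filter] at hb
    obtain ⟨-, p, hp1, hp2⟩ := hb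
    rw [Finset.mem_union, hA, hB, Finset.mem_filter, Finset.mem_filter]
    by_cases hab : a.val / g = b.val / g
    · exact Or.inl ⟨Finset.mem_univ _, hab⟩
    · refine Or.inr ⟨Finset.mem_univ _, ?_⟩
      have h1 := walk_bound hx.le hx1' h0 σ _ _ p (fun v hv => by
        refine lt_of_le_of_ne (ht_le v) fun hv' => hp2 ?_
        rw [← eq_root v hv']; exact hv)
      have h2 := h1.trans (Phi_mono hx.le σ (base a) (base b) hp1)
      have h3 : x ^ (4 * m) ≤ x ^ p.length := pow_le_pow_of_le_one hx.le hx1' hp1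
      have h4 : x ^ (4 * m) = (6 ^ m : ℝ)⁻¹ := by rw [pow_mul, hx4, one_div, inv_pow]
      rw [← h4]
      have h5 := h3.trans h2
      simp only [Phi] at h5
      rw [ker_base_zero hm x a b hab, zero_add] at h5
      exact h5
  have cA : (A.card : ℝ) ≤ 6 ^ m / 3 := by
    have := card_fiber (6 ^ m) g a.val (gg_pos _ _ _)
    have h1 : (A.card : ℝ) ≤ g := by exact_mod_cast this
    have h2 : (3 : ℝ) * g = 6 ^ m := by exact_mod_cast hg3
    linarith
  have cB : (B.card : ℝ) ≤ 6 ^ m / 6 := by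
    have hnn : ∀ b : Fin (6 ^ m), 0 ≤ ∑ c, wt x σ (base (t := t) a) (4 * m) c * ker x (pos (t := t) c) (base b) :=
      fun b => Finset.sum_nonneg fun c _ => mul_nonneg (wt_nonneg hx.le σ _ _ c) (ker_nonneg hx.le _ _)
    have h1 : (B.card : ℝ) * (6 ^ m : ℝ)⁻¹ ≤
        ∑ b : Fin (6 ^ m), ∑ c, wt x σ (base (t := t) a) (4 * m) c * ker x (pos (t := t) c) (base b) := by
      rw [← nsmul_eq_mul, ← Finset.sum_const]
      refine (Finset.sum_le_sum fun b hb => (Finset.mem_filter.1 hb).2).trans ?_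
      exact Finset.sum_le_sum_of_subset_of_nonneg (Finset.subset_univ _) fun b _ _ => hnn b
    have h2 : ∑ b : Fin (6 ^ m), ∑ c, wt x σ (base (t := t) a) (4 * m) c * ker x (pos (t := t) c) (base b) ≤ 1 / 6 := by
      rw [Finset.sum_comm]
      have : ∀ c, ∑ b : Fin (6 ^ m), wt x σ (base (t := t) a) (4 * m) c * ker x (pos (t := t) c) (base b)
          ≤ wt x σ (base (t := t) a) (4 * m) c * 12 := fun c => by
        rw [← Finset.mul_sum]
        exact mul_le_mul_of_nonneg_left (sum_v hx hx1' hx4 c) (wt_nonneg hx.le σ _ _ c)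
      refine (Finset.sum_le_sum fun c _ => this c).trans ?_
      rw [← Finset.sum_mul]
      have := wt_sum hx hx1 hx4 hxt σ a (4 * m)
      linarith
    have h3 := h1.trans h2
    have h6 : (0 : ℝ) < 6 ^ m := by positivity
    rw [← div_eq_mul_inv, div_le_iff₀ h6] at h3
    linarith
  have h1 := (Finset.card_le_card hsub).trans (Finset.card_union_le A B)
  have h2 : ((Finset.univ.filter fun b : Fin (6 ^ m) => ∃ p : (GG h0 σ).Walk (base b) (base a),
      p.length ≤ 4 * m ∧ root ∉ p.support).card : ℝ) ≤ A.card + B.card := by exact_mod_cast h1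
  linarith

lemma base_inj : Function.Injective (base (t := t) (m := m)) := fun a b h =>
  Fin.ext (congrArg xx h)

lemma good_pairs (h0 : 0 < t) (hm : 1 ≤ m) (σ : Sig m) {x : ℝ} (hx : 0 < x) (hx1 : x ≤ 2 / 3)
    (hx4 : x ^ 4 = 1 / 6) (hxt : x ^ t ≤ 1 / 14040) :
    ((6 : ℝ) ^ m) ^ 2 / 2 ≤ (Set.ncard {q : VT t m × VT t m | q.1 ≠ q.2 ∧
      ∀ pth : (GG h0 σ).Walk q.1 q.2, pth.IsPath →
        pth.length = (GG h0 σ).dist q.1 q.2 → root ∈ pth.support} : ℝ) := by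
  classical
  let bad : Fin (6 ^ m) → Finset (Fin (6 ^ m)) := fun a =>
    Finset.univ.filter fun b : Fin (6 ^ m) => ∃ p : (GG h0 σ).Walk (base b) (base a),
      p.length ≤ 4 * m ∧ root ∉ p.support
  let F : Finset (Σ _ : Fin (6 ^ m), Fin (6 ^ m)) := Finset.univ.sigma fun a => (bad a)ᶜ
  have hF : ((6 : ℝ) ^ m) ^ 2 / 2 ≤ (F.card : ℝ) := by
    rw [Finset.card_sigma]
    push_cast
    have : ∀ a ∈ (Finset.univ : Finset (Fin (6 ^ m))), (6 : ℝ) ^ m / 2 ≤ ((bad a)ᶜ.card : ℝ) := by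
      intro a _
      have h1 := bad_card h0 hm σ hx hx1 hx4 hxt a
      have h2 := Finset.card_add_card_compl (bad a)
      rw [Fintype.card_fin] at h2
      have h3 : ((bad a).card : ℝ) + ((bad a)ᶜ.card : ℝ) = 6 ^ m := by exact_mod_cast h2
      have h1' : ((bad a).card : ℝ) ≤ 6 ^ m / 2 := h1
      linarith
    refine le_trans ?_ (Finset.sum_le_sum this)
    simp only [Finset.sum_const, Finset.card_univ, Fintype.card_fin, nsmul_eq_mul]
    push_cast
    linarith [sq ((6 : ℝ) ^ m)]
  refine hF.trans ?_
  rw [← Set.ncard_coe_finset F]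
  refine Nat.cast_le.2 (Set.ncard_le_ncard_of_injOn (fun s => (base s.2, base s.1)) ?_ ?_ (Set.toFinite _))
  · rintro ⟨a, b⟩ hab
    have hb : b ∉ bad a := by
      have := Finset.mem_sigma.1 (Finset.mem_coe.1 hab)
      exact Finset.mem_compl.1 this.2
    have key : ∀ p : (GG h0 σ).Walk (base b) (base a), p.length ≤ 4 * m → root ∈ p.support := by
      intro p hp
      by_contra h
      exact hb (Finset.mem_filter.2 ⟨Finset.mem_univ _, p, hp, h⟩)
    refine ⟨fun h => ?_, fun p _ hp => key p (hp.le.trans (dist_base h0 σ a b))⟩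
    have hba : b = a := base_inj h
    subst hba
    have := key Walk.nil (by simp)
    rw [Walk.support_nil, List.mem_singleton] at this
    have h2 := congrArg ht this
    have h3 : 8 * t + 2 * m = 8 * t := h2
    omega
  · rintro ⟨a, b⟩ _ ⟨a', b'⟩ _ h
    have h1 : b = b' := base_inj (congrArg Prod.fst h)
    have h2 : a = a' := base_inj (congrArg Prod.snd h)
    rw [h1, h2]

end Congestion

section Expansion
variable {t m : ℕ}

open Classical in
noncomputable def bd (h0 : 0 < t) (σ : Sig m) (S : Finset (VT t m)) : Finset (VT t m × VT t m) :=
  Finset.univ.filter fun e => e.1 ∈ S ∧ e.2 ∉ S ∧ (GG h0 σ).Adj e.1 e.2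

lemma mem_bd (h0 : 0 < t) (σ : Sig m) (S : Finset (VT t m)) (e : VT t m × VT t m) :
    e ∈ bd h0 σ S ↔ e.1 ∈ S ∧ e.2 ∉ S ∧ (GG h0 σ).Adj e.1 e.2 := by
  unfold bd; simp

open Classical in
noncomputable def XX (S : Finset (VT t m)) : Finset (Fin (6 ^ m)) :=
  Finset.univ.filter fun a => base a ∈ S

open Classical in
noncomputable def YY (S : Finset (VT t m)) : Finset (Fin (6 ^ m)) :=
  Finset.univ.filter fun a => ∃ h hh, ¬ (low h hh a ∈ S ↔ base a ∈ S)

lemma mem_XX (S : Finset (VT t m)) (a) : a ∈ XX S ↔ base a ∈ S := by unfold XX; simp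

lemma not_mem_YY (S : Finset (VT t m)) (a) (h : a ∉ YY S) (k : ℕ) (hk : k ≤ 8 * t) :
    low k hk a ∈ S ↔ base a ∈ S := by
  by_contra hc
  exact h (by unfold YY; rw [Finset.mem_filter]; exact ⟨Finset.mem_univ _, k, hk, hc⟩)

lemma up_low (k : ℕ) (hk : k + 1 ≤ 8 * t) (a : Fin (6 ^ m)) :
    up (low k (by omega) a) (low (t := t) (k + 1) hk a) := ⟨rfl, rfl⟩

lemma YY_card (h0 : 0 < t) (σ : Sig m) (S : Finset (VT t m)) : (YY S).card ≤ (bd h0 σ S).card := by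
  classical
  refine le_trans (Finset.card_le_card (t := (bd h0 σ S).image fun e => e.1.1.2) ?_) Finset.card_image_le
  intro a ha
  by_contra hc
  have step : ∀ k (hk : k + 1 ≤ 8 * t), low k (by omega) a ∈ S ↔ low (k + 1) hk a ∈ S := by
    intro k hk
    by_contra hne
    apply hc
    rw [Finset.mem_image]
    by_cases h1 : low k (by omega) a ∈ S
    · refine ⟨(low k (by omega) a, low (k + 1) hk a), ?_, rfl⟩
      rw [mem_bd]
      exact ⟨h1, fun h2 => hne (by simp [h1, h2]), Or.inl (up_low k hk a)⟩
    · have h2 : low (k + 1) hk a ∈ S := by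
        by_contra h2
        exact hne (by simp [h1, h2])
      refine ⟨(low (k + 1) hk a, low k (by omega) a), ?_, rfl⟩
      rw [mem_bd]
      exact ⟨h2, h1, Or.inr (Or.inl (up_low k hk a))⟩
  have all : ∀ j k (hk : k ≤ 8 * t), k + j = 8 * t → (low k hk a ∈ S ↔ base a ∈ S) := by
    intro j
    induction j with
    | zero =>
      intro k hk h
      have : k = 8 * t := h
      subst this
      rfl
    | succ j ih =>
      intro k hk h
      rw [step k (by omega)]
      exact ih (k + 1) (by omega) (by omega)
  unfold YY at ha
  obtain ⟨-, k, hk, hne⟩ := Finset.mem_filter.1 ha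
  exact hne (all (8 * t - k) k hk (by omega))

open Classical in
lemma cross_card (h0 : 0 < t) (σ : Sig m) (S : Finset (VT t m)) :
    (Finset.univ.filter fun c => c.1 ∈ XX S ∧ (σ.s c).1 ∉ XX S).card ≤ 17 * (bd h0 σ S).card := by
  set Z := Finset.univ.filter fun c => pos c ∈ S ∧ pos (σ.s c) ∉ S with hZ
  set P := YY S ×ˢ (Finset.univ : Finset (Fin 8)) with hP
  have hPc : P.card = (YY S).card * 8 := by rw [hP, Finset.card_product]; simp
  have hZc : Z.card ≤ (bd h0 σ S).card := by
    refine Finset.card_le_card_of_injOn (fun c => (pos c, pos (σ.s c))) ?_ ?_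
    · intro c hc
      have := (Finset.mem_filter.1 hc).2
      exact (mem_bd _ _ _ _).2 ⟨this.1, this.2, Or.inr (Or.inr ⟨c, rfl, rfl⟩)⟩
    · intro c _ c' _ h
      exact pos_inj h0 (congrArg Prod.fst h)
  have hsub : (Finset.univ.filter fun c => c.1 ∈ XX S ∧ (σ.s c).1 ∉ XX S) ⊆ (P ∪ P.image σ.s) ∪ Z := by
    intro c hc
    obtain ⟨-, h1, h2⟩ := Finset.mem_filter.1 hc
    rw [Finset.mem_union, Finset.mem_union]
    by_cases k1 : c.1 ∈ YY S
    · exact Or.inl (Or.inl (Finset.mem_product.2 ⟨k1, Finset.mem_univ _⟩))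
    by_cases k2 : (σ.s c).1 ∈ YY S
    · exact Or.inl (Or.inr (Finset.mem_image.2 ⟨σ.s c, Finset.mem_product.2 ⟨k2, Finset.mem_univ _⟩, σ.inv c⟩))
    · refine Or.inr (Finset.mem_filter.2 ⟨Finset.mem_univ _, ?_, ?_⟩)
      · exact (not_mem_YY S c.1 k1 _ (port_le t c.2)).2 ((mem_XX _ _).1 h1)
      · intro h
        exact h2 ((mem_XX _ _).2 ((not_mem_YY S (σ.s c).1 k2 _ (port_le t (σ.s c).2)).1 h))
  have e1 := Finset.card_le_card hsub
  have e2 := Finset.card_union_le (P ∪ P.image σ.s) Z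
  have e3 := Finset.card_union_le P (P.image σ.s)
  have e4 : (P.image σ.s).card ≤ P.card := Finset.card_image_le
  have e5 := YY_card h0 σ S
  omega

open Classical in
lemma low_card (S : Finset (VT t m)) :
    (S.filter fun z => ht z ≤ 8 * t).card ≤ (8 * t + 1) * ((XX S).card + (YY S).card) := by
  have : (S.filter fun z => ht z ≤ 8 * t).card ≤ (Finset.range (8 * t + 1) ×ˢ (XX S ∪ YY S)).card := by
    refine Finset.card_le_card_of_injOn (fun z => (ht z, z.1.2)) ?_ ?_
    · intro z hz
      obtain ⟨h1, h2⟩ := Finset.mem_filter.1 hz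
      refine Finset.mem_product.2 ⟨Finset.mem_range.2 (by simp only; omega), Finset.mem_union.2 ?_⟩
      by_cases k : z.1.2 ∈ YY S
      · exact Or.inr k
      · refine Or.inl ((mem_XX _ _).2 ((not_mem_YY S _ k (ht z) h2).1 ?_))
        have : low (ht z) h2 z.1.2 = z := vt_ext rfl rfl
        rw [this]; exact h1
    · intro z _ z' _ h
      exact vt_ext (congrArg Prod.fst h) (congrArg (fun p => p.2.val) h)
  refine this.trans ?_
  rw [Finset.card_product, Finset.card_range]
  exact Nat.mul_le_mul_left _ (Finset.card_union_le _ _)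

lemma two_children (z : VT t m) (hz : 8 * t < ht z) :
    ∃ w w' : VT t m, w ≠ w' ∧ up w z ∧ up w' z := by
  obtain ⟨h, hh⟩ : ∃ h, ht z = h + 1 := ⟨ht z - 1, by omega⟩
  have h2 := gg_two t m h (by omega)
  have hp := gg_pos t m h
  obtain ⟨k, hk⟩ := xx_dvd z
  have hd := gg_dvd t m (ht_le z)
  rw [gg_top] at hd
  obtain ⟨q, hq⟩ := hd
  have hlt := xx_lt z
  rw [hh] at hk hq
  have hkq : k < q := by
    rw [hk, hq] at hlt
    exact Nat.lt_of_mul_lt_mul_left hlt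
  have hle : gg t m (h + 1) * (k + 1) ≤ gg t m (h + 1) * q := Nat.mul_le_mul_left _ hkq
  rw [mul_add, ← hk, ← hq] at hle
  have hdz : gg t m h ∣ xx z := (gg_dvd t m (Nat.le_succ h)).trans ⟨k, hk⟩
  have hht := ht_le z
  refine ⟨mkV h (xx z) (by omega) hlt hdz, mkV h (xx z + gg t m h) (by omega) (by omega)
    (dvd_add hdz dvd_rfl), ?_, ⟨hh, rfl⟩, ⟨hh, ?_⟩⟩
  · intro e
    have := congrArg xx e
    simp only [xx_mkV] at this
    omega
  · rw [hh]
    simp only [xx_mkV]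
    rw [hk, Nat.mul_add_div (gg_pos _ _ _), Nat.div_eq_of_lt (by omega), add_zero,
      Nat.mul_div_cancel_left _ (gg_pos _ _ _)]

open Classical in
lemma int_card (h0 : 0 < t) (σ : Sig m) (S : Finset (VT t m)) :
    (S.filter fun z => 8 * t < ht z).card ≤ (XX S).card + (bd h0 σ S).card := by
  set I := S.filter fun z => 8 * t < ht z with hI
  set R := (I ∪ (XX S).image base) ∪ (bd h0 σ S).image Prod.snd with hR
  have key : I.card * 2 ≤ R.card * 1 := by
    refine Finset.card_mul_le_card_mul (fun z w => up w z) ?_ ?_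
    · intro z hz
      obtain ⟨hzS, hzh⟩ := Finset.mem_filter.1 hz
      have hmem : ∀ w, up w z → w ∈ R := by
        intro w hw
        rw [hR, Finset.mem_union, Finset.mem_union]
        by_cases hwS : w ∈ S
        · by_cases hwh : 8 * t < ht w
          · exact Or.inl (Or.inl (Finset.mem_filter.2 ⟨hwS, hwh⟩))
          · have e : ht w = 8 * t := by have := hw.1; omega
            have e2 : base w.1.2 = w := vt_ext e.symm rfl
            exact Or.inl (Or.inr (Finset.mem_image.2 ⟨w.1.2, (mem_XX _ _).2 (by rw [e2]; exact hwS), e2⟩))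
        · exact Or.inr (Finset.mem_image.2 ⟨(z, w), (mem_bd _ _ _ _).2 ⟨hzS, hwS, Or.inr (Or.inl hw)⟩, rfl⟩)
      obtain ⟨w, w', hne, h1, h2⟩ := two_children z hzh
      exact Finset.one_lt_card.2 ⟨w, Finset.mem_filter.2 ⟨hmem w h1, h1⟩, w',
        Finset.mem_filter.2 ⟨hmem w' h2, h2⟩, hne⟩
    · intro w _
      refine Finset.card_le_one.2 fun a ha b hb => ?_
      exact up_right_unique (Finset.mem_filter.1 ha).2 (Finset.mem_filter.1 hb).2
  have e1 : R.card ≤ (I ∪ (XX S).image (base (t := t))).card + ((bd h0 σ S).image Prod.snd).card :=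
    Finset.card_union_le _ _
  have e2 := Finset.card_union_le I ((XX S).image (base (t := t)))
  have e3 : ((XX S).image (base (t := t))).card ≤ (XX S).card := Finset.card_image_le
  have e4 : ((bd h0 σ S).image Prod.snd).card ≤ (bd h0 σ S).card := Finset.card_image_le
  omega

lemma S_card (h0 : 0 < t) (σ : Sig m) (S : Finset (VT t m)) :
    S.card ≤ (8 * t + 2) * ((XX S).card + (bd h0 σ S).card) := by
  classical
  have h1 := low_card S
  have h2 := int_card h0 σ S
  have h3 := Finset.card_filter_add_card_filter_not (s := S) (fun z => ht z ≤ 8 * t)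
  simp only [not_le] at h3
  have h4 := YY_card h0 σ S
  have h5 : (8 * t + 1) * ((XX S).card + (YY S).card) ≤ (8 * t + 1) * ((XX S).card + (bd h0 σ S).card) :=
    Nat.mul_le_mul_left _ (by omega)
  have h6 : (8 * t + 2) * ((XX S).card + (bd h0 σ S).card) =
    (8 * t + 1) * ((XX S).card + (bd h0 σ S).card) + ((XX S).card + (bd h0 σ S).card) := by ring
  omega

lemma V_card (h0 : 0 < t) (σ : Sig m) : Fintype.card (VT t m) ≤ (8 * t + 2) * 6 ^ m := by
  have h := S_card h0 σ Finset.univ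
  have h1 : (bd h0 σ Finset.univ).card = 0 := by
    rw [Finset.card_eq_zero, Finset.eq_empty_iff_forall_notMem]
    intro e he
    exact ((mem_bd _ _ _ _).1 he).2.1 (Finset.mem_univ _)
  have h2 : (XX (Finset.univ : Finset (VT t m))).card ≤ 6 ^ m := by
    have := Finset.card_le_univ (XX (Finset.univ : Finset (VT t m)))
    rwa [Fintype.card_fin] at this
  rw [h1, add_zero, Finset.card_univ] at h
  exact h.trans (Nat.mul_le_mul_left _ h2)

lemma V_card_ge : 6 ^ m ≤ Fintype.card (VT t m) := by
  have := Fintype.card_le_of_injective _ (base_inj (t := t) (m := m))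
  rwa [Fintype.card_fin] at this

open Classical in
def IsExp (σ : Sig m) : Prop := ∀ X : Finset (Fin (6 ^ m)), 2 * X.card ≤ 6 ^ m →
  (X.card : ℝ) ≤ 328 * ((Finset.univ.filter fun c => c.1 ∈ X ∧ (σ.s c).1 ∉ X).card : ℝ)

lemma half_exp (h0 : 0 < t) (σ : Sig m) (hσ : IsExp σ) (S : Finset (VT t m)) (hS : 2 * (XX S).card ≤ 6 ^ m) :
    (S.card : ℝ) ≤ (8 * t + 2) * 5577 * (bd h0 σ S).card := by
  classical
  have h1 := hσ (XX S) hS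
  have h2 := cross_card h0 σ S
  have h3 : ((Finset.univ.filter fun c => c.1 ∈ XX S ∧ (σ.s c).1 ∉ XX S).card : ℝ) ≤ 17 * (bd h0 σ S).card := by
    exact_mod_cast h2
  have h4 : (S.card : ℝ) ≤ (8 * t + 2) * ((XX S).card + (bd h0 σ S).card) := by
    exact_mod_cast S_card h0 σ S
  have h5 : ((XX S).card : ℝ) + (bd h0 σ S).card ≤ 5577 * (bd h0 σ S).card := by linarith
  have h6 := mul_le_mul_of_nonneg_left h5 (show (0 : ℝ) ≤ 8 * t + 2 by positivity)
  linarith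

lemma full_exp (h0 : 0 < t) (σ : Sig m) (hσ : IsExp σ) (S : Finset (VT t m))
    (hS : 2 * S.card ≤ Fintype.card (VT t m)) :
    (S.card : ℝ) ≤ (8 * t + 2) * 5577 * (bd h0 σ S).card := by
  classical
  by_cases hX : 2 * (XX S).card ≤ 6 ^ m
  · exact half_exp h0 σ hσ S hX
  · have e1 : XX Sᶜ = (XX S)ᶜ := by ext a; simp [mem_XX]
    have e2 := Finset.card_add_card_compl (XX S)
    rw [Fintype.card_fin] at e2
    have e3 := half_exp h0 σ hσ Sᶜ (by rw [e1]; omega)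
    have e4 : (bd h0 σ Sᶜ).card ≤ (bd h0 σ S).card := by
      refine Finset.card_le_card_of_injOn Prod.swap ?_ Prod.swap_injective.injOn
      intro e he
      have := (mem_bd _ _ _ _).1 he
      simp only [Finset.mem_compl, not_not] at this
      exact (mem_bd _ _ _ _).2 ⟨this.2.1, this.1, this.2.2.symm⟩
    have e5 := Finset.card_add_card_compl S
    have e6 : (S.card : ℝ) ≤ Sᶜ.card := by exact_mod_cast (show S.card ≤ Sᶜ.card by omega)
    have e7 : ((bd h0 σ Sᶜ).card : ℝ) ≤ (bd h0 σ S).card := by exact_mod_cast e4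
    have e8 := mul_le_mul_of_nonneg_left e7 (show (0 : ℝ) ≤ (8 * t + 2) * 5577 by positivity)
    linarith

end Expansion

section Transport

structure Good (α c : ℝ) {V : Type} (G : SimpleGraph V) : Prop where
  conn : G.Connected
  deg : ∀ v, (G.neighborSet v).ncard ≤ 4
  exp : ∀ S : Set V, S.Nonempty → 2 * S.ncard ≤ Nat.card V →
    α * (S.ncard : ℝ) ≤ (Set.ncard {e : V × V | e.1 ∈ S ∧ e.2 ∉ S ∧ G.Adj e.1 e.2} : ℝ)
  cong : ∃ w : V, c * (Nat.card V : ℝ) ^ 2 ≤ (Set.ncard {q : V × V | q.1 ≠ q.2 ∧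
    ∀ pth : G.Walk q.1 q.2, pth.IsPath → pth.length = G.dist q.1 q.2 → w ∈ pth.support} : ℝ)

lemma Good.transport {α c : ℝ} {V W : Type} [Finite V] [Finite W] {G : SimpleGraph V} {G' : SimpleGraph W}
    (f : G' ≃g G) (h : Good α c G) : Good α c G' := by
  have hcard : Nat.card W = Nat.card V := Nat.card_congr f.toEquiv
  refine ⟨f.connected_iff.2 h.conn, fun v => ?_, fun S hS hS2 => ?_, ?_⟩
  · refine le_trans (Set.ncard_le_ncard_of_injOn f (t := G.neighborSet (f v)) ?_ f.injective.injOn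
      (Set.toFinite _)) (h.deg (f v))
    intro w hw
    exact f.map_adj_iff.2 hw
  · have e1 : (f '' S).ncard = S.ncard := Set.ncard_image_of_injective S f.injective
    have h1 := h.exp (f '' S) (hS.image f) (by rw [e1, ← hcard]; exact hS2)
    rw [e1] at h1
    refine h1.trans (Nat.cast_le.2 ?_)
    refine Set.ncard_le_ncard_of_injOn (Prod.map f.symm f.symm) ?_
      (Function.Injective.injOn (Function.Injective.prodMap f.symm.injective f.symm.injective)) (Set.toFinite _)
    rintro ⟨a, b⟩ ⟨⟨a', ha', haa⟩, hb, hab⟩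
    obtain ⟨b', rfl⟩ := f.surjective b
    have haa' : f a' = a := haa
    subst haa'
    have q1 : f.symm (f a') = a' := f.symm_apply_apply a'
    have q2 : f.symm (f b') = b' := f.symm_apply_apply b'
    refine ⟨?_, ?_, ?_⟩
    · simp only [Prod.map]; rw [q1]; exact ha'
    · simp only [Prod.map]; rw [q2]; exact fun hb' => hb ⟨b', hb', rfl⟩
    · simp only [Prod.map]; rw [q1, q2]; exact f.map_adj_iff.1 hab
  · obtain ⟨w, hw⟩ := h.cong
    obtain ⟨w', rfl⟩ := f.surjective w
    refine ⟨w', ?_⟩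
    rw [hcard]
    refine hw.trans (Nat.cast_le.2 ?_)
    refine le_trans (Set.ncard_le_ncard (t := Prod.map f f '' _) ?_ (Set.toFinite _)) (Set.ncard_image_le (Set.toFinite _))
    rintro ⟨a, b⟩ ⟨hne, hp⟩
    obtain ⟨a', rfl⟩ := f.surjective a
    obtain ⟨b', rfl⟩ := f.surjective b
    refine ⟨(a', b'), ⟨fun hh => hne (congrArg f hh), ?_⟩, rfl⟩
    intro p hpath hlen
    have hl : (p.map f.toHom).length = G.dist (f a') (f b') := by
      rw [Walk.length_map, hlen]
      apply le_antisymm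
      · obtain ⟨q, hq⟩ := (h.conn.preconnected (f a') (f b')).exists_walk_length_eq_dist
        have := dist_le ((q.map f.symm.toHom).copy (f.symm_apply_apply a') (f.symm_apply_apply b'))
        rw [Walk.length_copy, Walk.length_map] at this
        exact this.trans hq.le
      · have h2 := dist_le (p.map f.toHom)
        rw [Walk.length_map, hlen] at h2
        exact h2
    have h3 := hp (p.map f.toHom) (hpath.map f.injective) hl
    rw [Walk.support_map, List.mem_map] at h3
    obtain ⟨v, hv, hvw⟩ := h3
    rw [← f.injective hvw]
    exact hv

end Transport

section Final

lemma exists_x : ∃ x : ℝ, 0 < x ∧ x ≤ 2 / 3 ∧ x ^ 4 = 1 / 6 := by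
  refine ⟨Real.sqrt (Real.sqrt (1 / 6)), by positivity, ?_, ?_⟩
  · rw [Real.sqrt_le_left (by norm_num), Real.sqrt_le_left (by norm_num)]; norm_num
  · rw [show ∀ y : ℝ, y ^ 4 = (y ^ 2) ^ 2 from fun y => by ring, Real.sq_sqrt (by positivity), Real.sq_sqrt (by positivity)]

lemma exists_good (k : ℕ) (hk : 1 ≤ k) : ∃ (V : Type) (_ : Fintype V) (G : SimpleGraph V),
    6 ^ (2 * k) ≤ Nat.card V ∧ Good (1 / (194 * 5577)) (1 / (2 * 194 ^ 2)) G := by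
  have : NeZero (6 ^ k) := ⟨by positivity⟩
  obtain ⟨s, s1, s2, s3⟩ := exists_sigma (6 ^ k) (6 ^ (2 * k)) (by rw [← pow_mul, mul_comm])
  let σ : Sig (2 * k) := ⟨s, s1, s2⟩
  have h0 : 0 < 24 := by norm_num
  have hσ : IsExp σ := s3
  refine ⟨VT 24 (2 * k), inferInstance, GG h0 σ, ?_, GG_conn h0 σ, deg_le h0 σ, ?_, root, ?_⟩
  · rw [Nat.card_eq_fintype_card]; exact V_card_ge
  · intro S _ hS
    classical
    have e1 : S.ncard = S.toFinset.card := Set.ncard_eq_toFinset_card' S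
    rw [e1, Nat.card_eq_fintype_card] at hS
    have h := full_exp h0 σ hσ S.toFinset hS
    have e2 : {e : VT 24 (2 * k) × VT 24 (2 * k) | e.1 ∈ S ∧ e.2 ∉ S ∧ (GG h0 σ).Adj e.1 e.2}
        = ↑(bd h0 σ S.toFinset) := by
      ext e
      rw [Finset.mem_coe, mem_bd]
      simp
    rw [e2, Set.ncard_coe_finset, e1]
    push_cast at h
    linarith
  · obtain ⟨x, hx, hx1, hx4⟩ := exists_x
    have h := good_pairs h0 (show 1 ≤ 2 * k by omega) σ hx hx1 hx4 (by
      rw [show 24 = 4 * 6 by norm_num, pow_mul, hx4]; norm_num)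
    refine le_trans ?_ h
    rw [Nat.card_eq_fintype_card]
    have h1 : ((Fintype.card (VT 24 (2 * k)) : ℕ) : ℝ) ≤ 194 * 6 ^ (2 * k) := by
      exact_mod_cast V_card h0 σ
    have h2 := pow_le_pow_left₀ (by positivity) h1 2
    rw [mul_pow] at h2
    linarith

lemma exists_good_fin (B : ℕ) : ∃ n, B < n ∧ ∃ G : SimpleGraph (Fin n),
    Good (1 / (194 * 5577)) (1 / (2 * 194 ^ 2)) G := by
  obtain ⟨V, _, G, h1, h2⟩ := exists_good (B + 1) (by omega)
  refine ⟨Fintype.card V, ?_, G.comap (Fintype.equivFin V).symm, ?_⟩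
  · rw [Nat.card_eq_fintype_card] at h1
    have : 2 * (B + 1) < 6 ^ (2 * (B + 1)) := Nat.lt_pow_self (by norm_num)
    omega
  · exact Good.transport (Iso.comap (Fintype.equivFin V).symm G) h2

lemma exists_seq : ∃ (n : ℕ → ℕ), StrictMono n ∧ ∀ i, ∃ G : SimpleGraph (Fin (n i)),
    Good (1 / (194 * 5577)) (1 / (2 * 194 ^ 2)) G := by
  choose f hf1 hf2 using exists_good_fin
  refine ⟨fun i => f^[i + 1] 0, strictMono_nat_of_lt_succ fun i => ?_, fun i => ?_⟩
  · rw [Function.iterate_succ_apply' f (i + 1)]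
    exact hf1 _
  · have e : f^[i + 1] 0 = f (f^[i] 0) := Function.iterate_succ_apply' f i 0
    show ∃ G : SimpleGraph (Fin (f^[i + 1] 0)), Good (1 / (194 * 5577)) (1 / (2 * 194 ^ 2)) G
    rw [e]
    exact hf2 _

end Final

end ExpCong


/-- There is a family of constant-degree expanders with maximum vertex congestion
`Θ(n²)`: for some `α, c > 0` there are finite connected simple graphs of strictly
increasing sizes, of maximum degree at most 4 and edge expansion at least `α`,
each containing a vertex `w` that lies on every shortest path between at least
`c·n²` pairs of distinct vertices. (Pairs are counted here as ordered pairs; this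
only changes the constant `c` by a factor of two.) -/
theorem expanders_with_high_congestion :
    ∃ (α c : ℝ), 0 < α ∧ 0 < c ∧
      ∃ (n : ℕ → ℕ) (G : ∀ i : ℕ, SimpleGraph (Fin (n i))),
        StrictMono n ∧
        ∀ i : ℕ,
          (G i).Connected ∧
          (∀ v : Fin (n i), Set.ncard ((G i).neighborSet v) ≤ 4) ∧
          (∀ S : Set (Fin (n i)), S.Nonempty → 2 * S.ncard ≤ n i →
            α * (S.ncard : ℝ) ≤
              (Set.ncard {e : Fin (n i) × Fin (n i) |
                e.1 ∈ S ∧ e.2 ∉ S ∧ (G i).Adj e.1 e.2} : ℝ)) ∧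
          ∃ w : Fin (n i),
            c * (n i : ℝ) ^ 2 ≤
              (Set.ncard {q : Fin (n i) × Fin (n i) | q.1 ≠ q.2 ∧
                ∀ pth : (G i).Walk q.1 q.2, pth.IsPath →
                  pth.length = (G i).dist q.1 q.2 → w ∈ pth.support} : ℝ) := by
  obtain ⟨n, hn, hG⟩ := ExpCong.exists_seq
  choose G hG using hG
  refine ⟨1 / (194 * 5577), 1 / (2 * 194 ^ 2), by norm_num, by norm_num, n, G, hn, fun i => ?_⟩
  have h := hG i
  refine ⟨h.conn, h.deg, fun S hS hS2 => h.exp S hS (by rw [Nat.card_fin]; exact hS2), ?_⟩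
  obtain ⟨w, hw⟩ := h.cong
  rw [Nat.card_fin] at hw
  exact ⟨w, hw⟩
end

section
/- Let T be a finite tree, let L be its set of leaves (vertices of degree at most 1) and I its set of internal vertices (degree at least 2). Suppose every internal vertex has degree at least 3, except at most one vertex which may have degree 2. Then for every subset S of the vertices of T, the number of edges of T with exactly one endpoint in S is at least |S ∩ I| − |S ∩ L|. -/
open SimpleGraph

lemma acyclic_card_aux {W : Type*} [Fintype W] [Nonempty W] [DecidableEq W] (H : SimpleGraph W)
    [DecidableRel H.Adj] (hH : H.IsAcyclic) :
    H.edgeFinset.card + 1 ≤ Fintype.card W := by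
  classical
  obtain ⟨T, hT, hmax⟩ := exists_maximal_isAcyclic_of_le_isAcyclic (G := ⊤) le_top hH
  have hTree : T.IsTree := by
    rw [← maximal_isAcyclic_iff_isTree]
    simpa using hmax
  rw [← hTree.card_edgeFinset]
  have := Finset.card_le_card (SimpleGraph.edgeFinset_mono hT)
  omega

lemma inner_count_aux {V : Type*} [Fintype V] [DecidableEq V] (G : SimpleGraph V)
    [DecidableRel G.Adj] (hG : G.IsAcyclic) (S : Finset V) (hS : S.Nonempty) :
    ∑ v ∈ S, (S.filter (fun w => G.Adj v w)).card + 2 ≤ 2 * S.card := by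
  classical
  have : Nonempty (S : Set V) := hS.to_subtype
  have h1 := acyclic_card_aux (G.induce (S : Set V)) (hG.induce _)
  have h2 := (G.induce (S : Set V)).sum_degrees_eq_twice_card_edges
  have h3 : ∑ v ∈ S, (S.filter (fun w => G.Adj v w)).card
      = ∑ v : (S : Set V), (G.induce (S : Set V)).degree v := by
    rw [← Finset.sum_coe_sort]
    refine Finset.sum_congr rfl fun v _ => ?_
    rw [← SimpleGraph.card_neighborFinset_eq_degree]
    symm
    refine Finset.card_bij (fun w _ => (w : V)) ?_ ?_ ?_
    · intro a ha
      simpa using ha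
    · intro a _ b _ h
      exact Subtype.ext h
    · intro b hb
      rw [Finset.mem_filter] at hb
      exact ⟨⟨b, hb.1⟩, by simpa using hb.2, rfl⟩
  have h4 : Fintype.card (S : Set V) = S.card := by simp
  omega

/-- Fact 1 of the expander construction: in a finite tree all of whose internal
vertices (degree ≥ 2) have degree at least 3 except at most one vertex of degree 2,
the edge boundary of any vertex subset `S` has size at least `|S ∩ I| − |S ∩ L|`,
where `L` is the set of leaves (degree ≤ 1) and `I` the set of internal vertices. -/
theorem tree_edge_boundary_lower_bound {V : Type*} [Fintype V]
    (G : SimpleGraph V) (hT : G.IsTree)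
    (L I : Set V)
    (hL : L = {v | Set.ncard (G.neighborSet v) ≤ 1})
    (hI : I = {v | 2 ≤ Set.ncard (G.neighborSet v)})
    (hdeg : (∀ v ∈ I, 3 ≤ Set.ncard (G.neighborSet v)) ∨
      (∃ v₀ ∈ I, Set.ncard (G.neighborSet v₀) = 2 ∧
        ∀ v ∈ I, v ≠ v₀ → 3 ≤ Set.ncard (G.neighborSet v))) :
    ∀ S : Set V,
      ((S ∩ I).ncard : ℤ) - ((S ∩ L).ncard : ℤ) ≤
        (Set.ncard {e : V × V | e.1 ∈ S ∧ e.2 ∉ S ∧ G.Adj e.1 e.2} : ℤ) := by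
  classical
  intro S
  have hdg : ∀ v, Set.ncard (G.neighborSet v) = G.degree v := fun v => by
    rw [← SimpleGraph.card_neighborFinset_eq_degree, ← Set.ncard_coe_finset]
    simp
  simp only [hdg] at hL hI hdeg
  by_cases hne : (S ∩ I).Nonempty
  swap
  · rw [Set.not_nonempty_iff_eq_empty] at hne
    rw [hne, Set.ncard_empty]
    push_cast
    omega
  obtain ⟨x, hxS, hxI⟩ := hne
  have hpos : ∀ v, 1 ≤ G.degree v := by
    have hx2 : 2 ≤ G.degree x := by rw [hI] at hxI; exact hxI
    obtain ⟨y, hy⟩ := (G.degree_pos_iff_exists_adj x).1 (by omega)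
    have : Nontrivial V := ⟨x, y, hy.ne⟩
    intro v
    exact hT.connected.preconnected.degree_pos_of_nontrivial v
  set F := S.toFinset with hF
  have hFne : F.Nonempty := ⟨x, by simpa [hF] using hxS⟩
  have hin := inner_count_aux G hT.isAcyclic F hFne
  have hB : Set.ncard {e : V × V | e.1 ∈ S ∧ e.2 ∉ S ∧ G.Adj e.1 e.2}
      = ∑ v ∈ F, (Finset.univ.filter (fun w => w ∉ S ∧ G.Adj v w)).card := by
    rw [← Finset.card_sigma, ← Set.ncard_coe_finset]
    refine Set.ncard_congr (fun e _ => (⟨e.1, e.2⟩ : (_ : V) × V)) ?_ ?_ ?_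
    · rintro ⟨a, b⟩ h
      simpa [hF] using h
    · rintro ⟨a, b⟩ ⟨c, d⟩ _ _ h
      simpa using h
    · rintro ⟨a, b⟩ h
      exact ⟨(a, b), by simpa [hF] using h, rfl⟩
  have hsplit : ∀ v, G.degree v = (F.filter (fun w => G.Adj v w)).card +
      (Finset.univ.filter (fun w => w ∉ S ∧ G.Adj v w)).card := by
    intro v
    rw [← SimpleGraph.card_neighborFinset_eq_degree, ← Finset.card_union_of_disjoint]
    · congr 1
      ext w
      simp [hF]
      tauto
    · rw [Finset.disjoint_left]
      intro w
      simp [hF]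
      tauto
  have hsum : ∑ v ∈ F, G.degree v = ∑ v ∈ F, (F.filter (fun w => G.Adj v w)).card +
      ∑ v ∈ F, (Finset.univ.filter (fun w => w ∉ S ∧ G.Adj v w)).card := by
    rw [← Finset.sum_add_distrib]
    exact Finset.sum_congr rfl fun v _ => hsplit v
  have hi : (S ∩ I).ncard = (F.filter (fun v => 2 ≤ G.degree v)).card := by
    rw [← Set.ncard_coe_finset]
    congr 1
    ext v
    simp [hF, hI]
  have hl : (S ∩ L).ncard = (F.filter (fun v => ¬ 2 ≤ G.degree v)).card := by
    rw [← Set.ncard_coe_finset]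
    congr 1
    ext v
    simp [hF, hL]
  have hcard := Finset.card_filter_add_card_filter_not (s := F) (fun v => 2 ≤ G.degree v)
  have hex : ∃ v₀, ∀ v, 2 ≤ G.degree v → v ≠ v₀ → 3 ≤ G.degree v := by
    rcases hdeg with h | ⟨v₀, _, _, h⟩
    · exact ⟨x, fun v hv _ => h v (by rw [hI]; exact hv)⟩
    · exact ⟨v₀, fun v hv => h v (by rw [hI]; exact hv)⟩
  obtain ⟨v₀, hv₀⟩ := hex
  have hlow : ∑ v ∈ F, (1 + if 2 ≤ G.degree v then 2 else 0) ≤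
      ∑ v ∈ F, (G.degree v + if v = v₀ then 1 else 0) := by
    refine Finset.sum_le_sum fun v _ => ?_
    have := hpos v
    have := hv₀ v
    split_ifs <;> grind
  have hone : ∑ v ∈ F, (if v = v₀ then 1 else 0) ≤ 1 := by
    rw [Finset.sum_ite_eq']
    split_ifs <;> simp
  rw [Finset.sum_add_distrib, Finset.sum_add_distrib, ← Finset.sum_filter] at hlow
  simp only [Finset.sum_const, smul_eq_mul, mul_one] at hlow
  rw [hB, hi, hl]
  omega
end
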